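/- Let m be a natural number and let A be a finite non-empty subset of S_{4,m}. For every ε > 0 there is a constant C(ε) > 0, independent of m and A, such that E_{2,2}(A) ≤ C(ε) · m^ε · |A|^{2 + 1/3} and E_{2,3}(A) ≤ C(ε) · m^ε · ( |A|^{2 + 2/3} + |A| · (sup_n r_2(A, n))² ). -/

import Mathlib

open Finset

noncomputable section

/-- The set of lattice points on the sphere of radius `√m` in `ℤ^d`. -/
def latSphere (d m : ℕ) : Set (Fin d → ℤ) := {x | ∑ i, x i ^ 2 = (m : ℤ)}

/-- The energy `E_{s,k}(A)`: the number of `sk`-tuples from `A` arranged as `k` blocks of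
length `s`, all blocks having equal sums.  In particular `E_{2,2}(A)` counts 4-tuples with
`x₁ + x₂ = x₃ + x₄` and `E_{2,3}(A)` counts 6-tuples with `x₁ + x₂ = x₃ + x₄ = x₅ + x₆`. -/
def multiEnergy {V : Type*} [AddCommMonoid V] (s k : ℕ) (A : Set V) : ℕ :=
  Nat.card {f : Fin k → Fin s → V //
    (∀ j i, f j i ∈ A) ∧ ∀ j j', ∑ i, f j i = ∑ i, f j' i}

/-- The representation function `r_s(A, n)`: the number of `s`-tuples
`(x₁, …, x_s) ∈ A^s` with `x₁ + ⋯ + x_s = n`. -/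
def repCount {V : Type*} [AddCommMonoid V] (s : ℕ) (A : Set V) (n : V) : ℕ :=
  Nat.card {x : Fin s → V // (∀ i, x i ∈ A) ∧ ∑ i, x i = n}


/-- The divisor bound. -/
theorem aux_divisor_bound (ε : ℝ) (hε : 0 < ε) :
    ∃ C : ℝ, 1 ≤ C ∧ ∀ M : ℕ, 0 < M → ((Nat.divisors M).card : ℝ) ≤ C * (M : ℝ) ^ ε := by
  obtain ⟨B, hB⟩ := exists_nat_ge ((2 : ℝ) ^ (1 / ε))
  have hl2 : 0 < Real.log 2 := Real.log_pos (by norm_num)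
  set C0 : ℝ := max 1 (1 / (ε * Real.log 2)) with hC0
  have hC01 : 1 ≤ C0 := le_max_left _ _
  refine ⟨C0 ^ B, one_le_pow₀ hC01, ?_⟩
  intro M hM
  have hM0 : M ≠ 0 := hM.ne'
  rw [Nat.card_divisors hM0]
  push_cast
  have key : ∀ p ∈ M.primeFactors, ((M.factorization p : ℝ) + 1) ≤
      (if p < B then C0 else 1) * ((p : ℝ) ^ (M.factorization p)) ^ ε := by
    intro p hp
    have hpp := Nat.prime_of_mem_primeFactors hp
    set e := M.factorization p
    have hp2 : (2 : ℝ) ≤ p := by exact_mod_cast hpp.two_le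
    have hp0 : (0 : ℝ) < p := by linarith
    rw [← Real.rpow_natCast, ← Real.rpow_mul hp0.le]
    split_ifs with h
    · have h1 : (2 : ℝ) ^ ((e : ℝ) * ε) ≤ (p : ℝ) ^ ((e : ℝ) * ε) :=
        Real.rpow_le_rpow (by norm_num) hp2 (by positivity)
      have h2 : 1 + (e : ℝ) * ε * Real.log 2 ≤ (2 : ℝ) ^ ((e : ℝ) * ε) := by
        rw [Real.rpow_def_of_pos (by norm_num)]
        have := Real.add_one_le_exp (Real.log 2 * ((e : ℝ) * ε))
        linarith
      have h3 : (e : ℝ) + 1 ≤ C0 * (1 + (e : ℝ) * ε * Real.log 2) := by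
        have h4 : 1 ≤ C0 * (ε * Real.log 2) := by
          have h5 : 1 / (ε * Real.log 2) ≤ C0 := le_max_right _ _
          rwa [div_le_iff₀ (by positivity)] at h5
        have he : (0 : ℝ) ≤ e := by positivity
        nlinarith
      calc (e : ℝ) + 1 ≤ C0 * (1 + (e : ℝ) * ε * Real.log 2) := h3
        _ ≤ C0 * (p : ℝ) ^ ((e : ℝ) * ε) := by
          apply mul_le_mul_of_nonneg_left (h2.trans h1); linarith
    · have hpB : (2 : ℝ) ^ (1 / ε) ≤ p := hB.trans (by exact_mod_cast not_lt.mp h)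
      have h1 : (2 : ℝ) ≤ (p : ℝ) ^ ε := by
        have := Real.rpow_le_rpow (by positivity) hpB hε.le
        rwa [← Real.rpow_mul (by norm_num), one_div, inv_mul_cancel₀ hε.ne', Real.rpow_one] at this
      rw [one_mul, mul_comm, Real.rpow_mul hp0.le, Real.rpow_natCast]
      calc (e : ℝ) + 1 ≤ (2 : ℝ) ^ e := by
            have := Nat.lt_two_pow_self (n := e)
            exact_mod_cast this
        _ ≤ _ := pow_le_pow_left₀ (by norm_num) h1 e
  calc ∏ p ∈ M.primeFactors, ((M.factorization p : ℝ) + 1)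
      ≤ ∏ p ∈ M.primeFactors, ((if p < B then C0 else 1) * ((p : ℝ) ^ (M.factorization p)) ^ ε) :=
        Finset.prod_le_prod (fun p _ => by positivity) key
    _ = (∏ p ∈ M.primeFactors, (if p < B then C0 else 1)) *
        ∏ p ∈ M.primeFactors, ((p : ℝ) ^ (M.factorization p)) ^ ε := Finset.prod_mul_distrib
    _ ≤ C0 ^ B * (M : ℝ) ^ ε := by
      have e1 : ∏ p ∈ M.primeFactors, ((p : ℝ) ^ (M.factorization p)) ^ ε = (M : ℝ) ^ ε := by
        rw [Real.finsetProd_rpow]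
        · congr 1
          have := Nat.prod_factorization_pow_eq_self hM0
          conv_rhs => rw [← this]
          rw [Finsupp.prod]
          push_cast
          rfl
        · intros; positivity
      rw [e1]
      apply mul_le_mul_of_nonneg_right _ (by positivity)
      rw [Finset.prod_ite]
      simp only [Finset.prod_const, one_pow, mul_one]
      apply pow_le_pow_right₀ hC01
      calc (M.primeFactors.filter (fun p => p < B)).card ≤ (Finset.range B).card := by
            apply Finset.card_le_card
            intro p hp
            simp at hp ⊢
            exact hp.2
        _ = B := Finset.card_range B

theorem aux_sq_dvd_four {h D : ℕ} (hD : Squarefree D) (hh : h * h ∣ 4 * D) : h ∣ 2 := by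
  rcases Nat.even_or_odd h with he | ho
  · obtain ⟨k, hk⟩ := he
    have h1 : 4 * (k * k) ∣ 4 * D := by
      have : 4 * (k * k) = h * h := by subst hk; ring
      rwa [this]
    have h2 : k * k ∣ D := Nat.dvd_of_mul_dvd_mul_left (by norm_num) h1
    have h3 := Nat.isUnit_iff.mp (hD k h2)
    subst h3; subst hk; norm_num
  · have hc : Nat.Coprime (h * h) 4 := by
      have : Nat.Coprime h 2 := Nat.coprime_two_right.mpr ho
      have h4 : (4 : ℕ) = 2 * 2 := by norm_num
      rw [h4]
      exact (Nat.Coprime.mul_left this this).mul_right (Nat.Coprime.mul_left this this)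
    have h2 : h * h ∣ D := hc.dvd_of_dvd_mul_left hh
    have h3 := Nat.isUnit_iff.mp (hD h h2)
    subst h3; norm_num

/-- Two square roots of `-D` modulo `M` with equal gcd-invariant agree modulo `M / 2`. -/
theorem aux_roots_close {M D : ℕ} (hM : 0 < M) (hD : Squarefree D) (s0 s1 s2 : ℤ)
    (h0 : (M : ℤ) ∣ s0 ^ 2 + D) (h1 : (M : ℤ) ∣ s1 ^ 2 + D) (h2 : (M : ℤ) ∣ s2 ^ 2 + D)
    (hg : Int.gcd (s1 - s0) M = Int.gcd (s2 - s0) M) : (M : ℤ) ∣ 2 * (s1 - s2) := by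
  set g : ℕ := Int.gcd (s1 - s0) M with hgdef
  have hg0 : 0 < g := Int.gcd_pos_of_ne_zero_right _ (by exact_mod_cast hM.ne')
  have hgM : g ∣ M := by
    have : (g : ℤ) ∣ (M : ℤ) := Int.gcd_dvd_right _ _
    exact_mod_cast this
  obtain ⟨g', hg'⟩ := hgM
  have hgM' : (M : ℤ) = g * g' := by exact_mod_cast hg'
  have d1 : (g : ℤ) ∣ s1 - s0 := Int.gcd_dvd_left _ _
  have d2 : (g : ℤ) ∣ s2 - s0 := by rw [hg]; exact Int.gcd_dvd_left _ _
  have aux : ∀ s : ℤ, (M : ℤ) ∣ s ^ 2 + D → Int.gcd (s - s0) M = g → (g' : ℤ) ∣ s + s0 := by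
    intro s hs hgs
    have e : (M : ℤ) ∣ (s - s0) * (s + s0) := by
      have := dvd_sub hs h0
      have e2 : s ^ 2 + (D : ℤ) - (s0 ^ 2 + D) = (s - s0) * (s + s0) := by ring
      rwa [e2] at this
    have hdv : (g : ℤ) ∣ s - s0 := by rw [← hgs]; exact Int.gcd_dvd_left _ _
    obtain ⟨k, hk⟩ := hdv
    have hcop : IsCoprime k (g' : ℤ) := by
      rw [Int.isCoprime_iff_gcd_eq_one]
      have e3 : Int.gcd (g * k) (g * g') = g * Int.gcd k g' := by
        rw [Int.gcd_mul_left]; simp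
      rw [← hk, ← hgM', hgs] at e3
      have : g * Int.gcd k g' = g * 1 := by omega
      exact Nat.eq_of_mul_eq_mul_left hg0 this
    rw [hk, hgM', mul_assoc] at e
    have e4 : (g' : ℤ) ∣ k * (s + s0) :=
      Int.dvd_of_mul_dvd_mul_left (by exact_mod_cast hg0.ne') e
    exact hcop.symm.dvd_of_dvd_mul_left e4
  have a1 := aux s1 h1 rfl
  have a2 := aux s2 h2 hg.symm
  have b1 : (g : ℤ) ∣ s1 - s2 := by
    have := dvd_sub d1 d2
    have e : s1 - s0 - (s2 - s0) = s1 - s2 := by ring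
    rwa [e] at this
  have b2 : (g' : ℤ) ∣ s1 - s2 := by
    have := dvd_sub a1 a2
    have e : s1 + s0 - (s2 + s0) = s1 - s2 := by ring
    rwa [e] at this
  set h := Nat.gcd g g' with hh
  have hh2 : h ∣ 2 := by
    apply aux_sq_dvd_four hD
    have hhg : (h : ℤ) ∣ g := by exact_mod_cast Nat.gcd_dvd_left g g'
    have hhg' : (h : ℤ) ∣ g' := by exact_mod_cast Nat.gcd_dvd_right g g'
    have c1 : (h : ℤ) ∣ 2 * s0 := by
      have := dvd_sub (hhg'.trans a1) (hhg.trans d1)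
      have e : s1 + s0 - (s1 - s0) = 2 * s0 := by ring
      rwa [e] at this
    have c2 : (h : ℤ) * h ∣ 4 * (s0 ^ 2 + D) := by
      apply Dvd.dvd.mul_left
      apply dvd_trans _ h0
      rw [hgM']
      exact mul_dvd_mul hhg hhg'
    have c3 : (h : ℤ) * h ∣ 4 * s0 ^ 2 := by
      have := mul_dvd_mul c1 c1
      have e : 2 * s0 * (2 * s0) = 4 * s0 ^ 2 := by ring
      rwa [e] at this
    have c4 : (h : ℤ) * h ∣ 4 * (D : ℤ) := by
      have := dvd_sub c2 c3
      have e : 4 * (s0 ^ 2 + (D : ℤ)) - 4 * s0 ^ 2 = 4 * D := by ring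
      rwa [e] at this
    exact_mod_cast c4
  have hl : ((Nat.lcm g g' : ℕ) : ℤ) ∣ s1 - s2 := by
    have := Int.coe_lcm_dvd b1 b2
    simpa [Int.lcm] using this
  have e : (M : ℤ) = (h : ℤ) * (Nat.lcm g g' : ℕ) := by
    rw [hgM']
    exact_mod_cast (Nat.gcd_mul_lcm g g').symm
  rw [e]
  exact mul_dvd_mul (by exact_mod_cast hh2) hl

theorem aux_roots_card {M D : ℕ} (hM : 0 < M) (hD : Squarefree D) (R : Finset ℕ)
    (hR : ∀ s ∈ R, s < M ∧ (M : ℤ) ∣ (s : ℤ) ^ 2 + D) : R.card ≤ 2 * (Nat.divisors M).card := by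
  rcases R.eq_empty_or_nonempty with rfl | ⟨s0, hs0⟩
  · simp
  have hmaps : ∀ s ∈ R, (fun s : ℕ => (Int.gcd ((s : ℤ) - s0) M, decide (2 * s < M))) s ∈
      Nat.divisors M ×ˢ (Finset.univ : Finset Bool) := by
    intro s _
    simp only [Finset.mem_product, Nat.mem_divisors, Finset.mem_univ, and_true]
    refine ⟨?_, hM.ne'⟩
    have : ((Int.gcd ((s : ℤ) - s0) M : ℕ) : ℤ) ∣ (M : ℤ) := Int.gcd_dvd_right _ _
    exact_mod_cast this
  have hinj : Set.InjOn (fun s : ℕ => (Int.gcd ((s : ℤ) - s0) M, decide (2 * s < M))) R := by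
    intro s1 h1 s2 h2 h12
    simp only [Prod.mk.injEq] at h12
    obtain ⟨hg, hb⟩ := h12
    have hd := aux_roots_close hM hD s0 s1 s2 (hR _ hs0).2 (hR _ h1).2 (hR _ h2).2 hg
    have l1 := (hR _ h1).1
    have l2 := (hR _ h2).1
    have hz : 2 * ((s1 : ℤ) - s2) = 0 := by
      apply Int.eq_zero_of_abs_lt_dvd hd
      by_cases hc : 2 * s1 < M
      · have hc2 : 2 * s2 < M := by simpa [hc] using hb
        rw [abs_lt]; constructor <;> omega
      · have hc2 : ¬ 2 * s2 < M := by simpa [hc] using hb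
        rw [abs_lt]; constructor <;> omega
    omega
  have := Finset.card_le_card_of_injOn _ hmaps hinj
  rw [Finset.card_product] at this
  simp at this
  omega

theorem aux_prim_card {M D : ℕ} (hM : 0 < M) (hD : Squarefree D) (S : Finset (ℤ × ℤ))
    (hS : ∀ z ∈ S, z.1 ^ 2 + (D : ℤ) * z.2 ^ 2 = M ∧ IsCoprime z.1 z.2) :
    S.card ≤ 8 * (Nat.divisors M).card := by
  have hMZ : (0 : ℤ) < M := by exact_mod_cast hM
  have hex : ∀ z : ℤ × ℤ, ∃ s : ℕ, z ∈ S →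
      s < M ∧ (M : ℤ) ∣ z.1 - s * z.2 ∧ (M : ℤ) ∣ (s : ℤ) ^ 2 + D := by
    intro z
    by_cases hz : z ∈ S
    · obtain ⟨he, hc⟩ := hS z hz
      obtain ⟨X, Y⟩ := z
      simp only at he hc ⊢
      have hYM : IsCoprime Y (M : ℤ) := by
        rw [← he]
        have : IsCoprime Y (X ^ 2) := hc.symm.pow_right
        have h2 := IsCoprime.add_mul_left_right this ((D : ℤ) * Y)
        have h3 : X ^ 2 + (D : ℤ) * Y ^ 2 = X ^ 2 + Y * ((D : ℤ) * Y) := by ring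
        rw [h3]; exact h2
      obtain ⟨a, b, hab⟩ := hYM
      refine ⟨((X * a) % M).toNat, fun _ => ?_⟩
      have hnn : 0 ≤ (X * a) % M := Int.emod_nonneg _ hMZ.ne'
      have hlt : (X * a) % M < M := Int.emod_lt_of_pos _ hMZ
      have hcast : ((((X * a) % M).toNat : ℕ) : ℤ) = (X * a) % M := Int.toNat_of_nonneg hnn
      have hdvd : (M : ℤ) ∣ X - (X * a) % M * Y := by
        have e : (X * a) % M = X * a - M * (X * a / M) := by
          have := Int.mul_ediv_add_emod (X * a) M; linarith
        refine ⟨X * b + (X * a / M) * Y, ?_⟩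
        rw [e]
        linear_combination (-X) * hab
      refine ⟨by omega, by rw [hcast]; exact hdvd, ?_⟩
      rw [hcast]
      set s := (X * a) % M
      have h3 : (M : ℤ) ∣ Y ^ 2 * (s ^ 2 + D) := by
        obtain ⟨k, hk⟩ := hdvd
        refine ⟨1 - k * (X + s * Y), ?_⟩
        linear_combination he - (X + s * Y) * hk
      have hc' : IsCoprime (M : ℤ) (Y ^ 2) :=
        (IsCoprime.pow_left (⟨a, b, hab⟩ : IsCoprime Y (M : ℤ))).symm
      exact hc'.dvd_of_dvd_mul_left h3
    · exact ⟨0, fun h => absurd h hz⟩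
  choose s hs using hex
  have h1 : S.card ≤ 4 * (S.image s).card := by
    apply Finset.card_le_mul_card_image
    intro t ht
    obtain ⟨z0, hz0, rfl⟩ := Finset.mem_image.mp ht
    set T : Finset (ℤ × ℤ) := {((M : ℤ), 0), (-(M : ℤ), 0), (0, (M : ℤ)), (0, -(M : ℤ))} with hT
    have hTc : T.card ≤ 4 := Finset.card_le_four
    refine le_trans ?_ hTc
    apply Finset.card_le_card_of_injOn
      (fun z : ℤ × ℤ => (z.1 * z0.1 + D * z.2 * z0.2, z.1 * z0.2 - z0.1 * z.2))
    · intro z hz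
      simp only [Finset.coe_filter, Set.mem_ofPred_eq] at hz
      obtain ⟨hzS, hzs⟩ := hz
      obtain ⟨X, Y⟩ := z
      obtain ⟨X0, Y0⟩ := z0
      have e1 := (hS _ hzS).1
      have e0 := (hS _ hz0).1
      have d1 := (hs _ hzS).2.1
      have d0 := (hs _ hz0).2.1
      rw [hzs] at d1
      simp only at e1 e0 d1 d0 ⊢
      set σ : ℤ := (s (X0, Y0) : ℤ)
      have hW : (M : ℤ) ∣ X * Y0 - X0 * Y := by
        obtain ⟨k, hk⟩ := d1
        obtain ⟨k0, hk0⟩ := d0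
        exact ⟨k * Y0 - k0 * Y, by linear_combination Y0 * hk - Y * hk0⟩
      obtain ⟨k, hk⟩ := hW
      have hid : (X * X0 + D * Y * Y0) ^ 2 + D * (X * Y0 - X0 * Y) ^ 2 = (M : ℤ) ^ 2 := by
        linear_combination (X0 ^ 2 + D * Y0 ^ 2) * e1 + (M : ℤ) * e0
      have hD0 : (1 : ℤ) ≤ D := by
        have : D ≠ 0 := hD.ne_zero
        omega
      rw [hk] at hid ⊢
      set U := X * X0 + D * Y * Y0
      have hUd : U ^ 2 + (D * k ^ 2) * (M : ℤ) ^ 2 = (M : ℤ) ^ 2 := by linear_combination hid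
      have hM2 : (0 : ℤ) < (M : ℤ) ^ 2 := by positivity
      have hk1 : (D : ℤ) * k ^ 2 ≤ 1 := by
        by_contra hcon
        push Not at hcon
        nlinarith [sq_nonneg U]
      have hkk : k ^ 2 ≤ 1 := by nlinarith [sq_nonneg k]
      have hk3 : k = 0 ∨ k = 1 ∨ k = -1 := by
        have : -1 ≤ k := by nlinarith
        have : k ≤ 1 := by nlinarith
        omega
      simp only [hT, Finset.coe_insert, Finset.coe_singleton, Set.mem_insert_iff,
        Set.mem_singleton_iff, Prod.mk.injEq]
      rcases hk3 with rfl | rfl | rfl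
      · have : U ^ 2 = (M : ℤ) ^ 2 := by linear_combination hUd
        rcases sq_eq_sq_iff_eq_or_eq_neg.mp this with h | h <;> simp [h]
      · have hD1 : (D : ℤ) = 1 := by linarith
        have : U ^ 2 = 0 := by rw [hD1] at hUd; linear_combination hUd
        have := pow_eq_zero_iff (two_ne_zero) |>.mp this
        simp [this]
      · have hD1 : (D : ℤ) = 1 := by linarith
        have : U ^ 2 = 0 := by rw [hD1] at hUd; linear_combination hUd
        have := pow_eq_zero_iff (two_ne_zero) |>.mp this
        simp [this]
    · intro z _ z' _ h
      obtain ⟨X, Y⟩ := z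
      obtain ⟨X', Y'⟩ := z'
      obtain ⟨X0, Y0⟩ := z0
      have e0 := (hS _ hz0).1
      simp only [Prod.mk.injEq] at h e0 ⊢
      obtain ⟨ha, hb⟩ := h
      constructor
      · apply mul_right_cancel₀ hMZ.ne'
        linear_combination (-(X - X')) * e0 + X0 * ha + D * Y0 * hb
      · apply mul_right_cancel₀ hMZ.ne'
        linear_combination (-(Y - Y')) * e0 + Y0 * ha - X0 * hb
  have h2 : (S.image s).card ≤ 2 * (Nat.divisors M).card := by
    apply aux_roots_card hM hD
    intro t ht
    obtain ⟨z, hz, rfl⟩ := Finset.mem_image.mp ht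
    exact ⟨(hs z hz).1, (hs z hz).2.2⟩
  omega

theorem aux_norm_card_sqf {M D : ℕ} (hM : 0 < M) (hD : Squarefree D) (S : Finset (ℤ × ℤ))
    (hS : ∀ z ∈ S, z.1 ^ 2 + (D : ℤ) * z.2 ^ 2 = M) :
    S.card ≤ 8 * (Nat.divisors M).card * (Nat.divisors M).card := by
  have hMZ : (0 : ℤ) < M := by exact_mod_cast hM
  have hgcd : ∀ z ∈ S, 0 < Int.gcd z.1 z.2 ∧ (Int.gcd z.1 z.2) ^ 2 ∣ M := by
    intro z hz
    have e := hS z hz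
    have hne : Int.gcd z.1 z.2 ≠ 0 := by
      intro h
      rw [Int.gcd_eq_zero_iff] at h
      rw [h.1, h.2] at e
      simp at e
      omega
    refine ⟨Nat.pos_of_ne_zero hne, ?_⟩
    have : ((Int.gcd z.1 z.2 : ℕ) : ℤ) ^ 2 ∣ (M : ℤ) := by
      rw [← e]
      exact dvd_add (pow_dvd_pow_of_dvd (Int.gcd_dvd_left _ _) 2)
        (Dvd.dvd.mul_left (pow_dvd_pow_of_dvd (Int.gcd_dvd_right _ _) 2) _)
    exact_mod_cast this
  have h1 : S.card ≤ (8 * (Nat.divisors M).card) *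
      (S.image (fun z => Int.gcd z.1 z.2)).card := by
    apply Finset.card_le_mul_card_image
    intro d hd
    obtain ⟨z0, hz0, rfl⟩ := Finset.mem_image.mp hd
    obtain ⟨hd0, hdM⟩ := hgcd z0 hz0
    set d := Int.gcd z0.1 z0.2 with hdd
    obtain ⟨M', hM'⟩ := hdM
    have hM'0 : 0 < M' := by
      rcases Nat.eq_zero_or_pos M' with h | h
      · rw [h] at hM'; omega
      · exact h
    have hdiv : (Nat.divisors M').card ≤ (Nat.divisors M).card :=
      Finset.card_le_card (Nat.divisors_subset_of_dvd hM.ne' ⟨d ^ 2, by rw [hM']; ring⟩)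
    set F := S.filter (fun z => Int.gcd z.1 z.2 = d) with hF
    have hFz : ∀ z ∈ F, z.1 = d * (z.1 / d) ∧ z.2 = d * (z.2 / d) := by
      intro z hz
      simp only [hF, Finset.mem_filter] at hz
      constructor
      · exact (Int.mul_ediv_cancel' (by rw [← hz.2]; exact Int.gcd_dvd_left _ _)).symm
      · exact (Int.mul_ediv_cancel' (by rw [← hz.2]; exact Int.gcd_dvd_right _ _)).symm
    have hcard : F.card = (F.image (fun z : ℤ × ℤ => (z.1 / (d : ℤ), z.2 / (d : ℤ)))).card := by
      rw [Finset.card_image_of_injOn]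
      intro z hz z' hz' h
      simp only [Prod.mk.injEq] at h
      have a := hFz z hz
      have b := hFz z' hz'
      ext
      · rw [a.1, b.1, h.1]
      · rw [a.2, b.2, h.2]
    have := aux_prim_card hM'0 hD (F.image (fun z : ℤ × ℤ => (z.1 / (d : ℤ), z.2 / (d : ℤ)))) (by
      intro w hw
      obtain ⟨z, hz, rfl⟩ := Finset.mem_image.mp hw
      have a := hFz z hz
      have hz' := hz
      simp only [hF, Finset.mem_filter] at hz'
      have e := hS z hz'.1
      have hdZ : (0 : ℤ) < (d : ℤ) ^ 2 := by positivity
      constructor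
      · apply mul_left_cancel₀ hdZ.ne'
        have e2 : ((d : ℤ) * (z.1 / d)) ^ 2 + (D : ℤ) * ((d : ℤ) * (z.2 / d)) ^ 2 = M := by
          rw [← a.1, ← a.2]; exact e
        have e3 : (M : ℤ) = (d : ℤ) ^ 2 * M' := by exact_mod_cast hM'
        rw [← e3, ← e2]; ring
      · simp only
        rw [Int.isCoprime_iff_gcd_eq_one, Int.gcd_ediv (by rw [← hz'.2]; exact Int.gcd_dvd_left _ _)
          (by rw [← hz'.2]; exact Int.gcd_dvd_right _ _), hz'.2]
        simp only [Int.natAbs_natCast]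
        exact Nat.div_self hd0)
    rw [hcard]
    calc _ ≤ _ := this
      _ ≤ _ := by omega
  have h2 : (S.image (fun z => Int.gcd z.1 z.2)).card ≤ (Nat.divisors M).card := by
    apply Finset.card_le_card
    intro d hd
    obtain ⟨z0, hz0, rfl⟩ := Finset.mem_image.mp hd
    rw [Nat.mem_divisors]
    exact ⟨(Dvd.intro_left _ (by ring : Int.gcd z0.1 z0.2 * Int.gcd z0.1 z0.2 = _)).trans
      (hgcd z0 hz0).2, hM.ne'⟩
  exact h1.trans (Nat.mul_le_mul_left _ h2)

theorem aux_norm_card {M Δ : ℕ} (hM : 0 < M) (hΔ : 0 < Δ) (S : Finset (ℤ × ℤ))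
    (hS : ∀ z ∈ S, z.1 ^ 2 + (Δ : ℤ) * z.2 ^ 2 = M) :
    S.card ≤ 8 * (Nat.divisors M).card * (Nat.divisors M).card := by
  obtain ⟨a, b, hab, hsq⟩ := Nat.sq_mul_squarefree Δ
  have hb : b ≠ 0 := by
    rintro rfl
    simp at hab
    omega
  have hcard : S.card = (S.image (fun z : ℤ × ℤ => (z.1, (b : ℤ) * z.2))).card := by
    rw [Finset.card_image_of_injective]
    intro z z' h
    simp only [Prod.mk.injEq] at h
    ext
    · exact h.1
    · exact mul_left_cancel₀ (by exact_mod_cast hb) h.2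
  rw [hcard]
  apply aux_norm_card_sqf hM hsq
  intro w hw
  obtain ⟨z, hz, rfl⟩ := Finset.mem_image.mp hw
  have e := hS z hz
  have e2 : (Δ : ℤ) = (b : ℤ) ^ 2 * a := by exact_mod_cast hab.symm
  rw [e2] at e
  simp only
  rw [← e]; ring

theorem aux_conic (ε : ℝ) (hε : 0 < ε) : ∃ C : ℝ, 1 ≤ C ∧ ∀ B : ℕ, 1 ≤ B → ∀ a b c e f : ℤ,
    |a| ≤ B → |b| ≤ B → |c| ≤ B → |e| ≤ B → |f| ≤ B → 0 < 4 * a * c - b ^ 2 →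
    ∀ S : Finset (ℤ × ℤ), (∀ z ∈ S, a * z.1 ^ 2 + b * z.1 * z.2 + c * z.2 ^ 2 + e * z.1 + f * z.2 = 0) →
    (S.card : ℝ) ≤ C * (B : ℝ) ^ ε := by
  obtain ⟨C₁, hC₁, hdiv⟩ := aux_divisor_bound (ε / 8) (by positivity)
  have h56 : (1 : ℝ) ≤ (56 : ℝ) ^ (ε / 4) := Real.one_le_rpow (by norm_num) (by positivity)
  have hCC : (1 : ℝ) ≤ 8 * C₁ ^ 2 * (56 : ℝ) ^ (ε / 4) := by nlinarith [mul_le_mul hC₁ hC₁ (by norm_num) (by linarith)]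
  refine ⟨8 * C₁ ^ 2 * (56 : ℝ) ^ (ε / 4), hCC, ?_⟩
  intro B hB a b c e f ha hb hc he hf hΔ S hS
  have hBR : (1 : ℝ) ≤ B := by exact_mod_cast hB
  have hBZ : (1 : ℤ) ≤ B := by exact_mod_cast hB
  have hBe : (1 : ℝ) ≤ (B : ℝ) ^ ε := Real.one_le_rpow hBR hε.le
  have ha0 : a ≠ 0 := by
    rintro rfl
    nlinarith [sq_nonneg b]
  obtain ⟨Δ, hΔd⟩ : ∃ Δ : ℕ, (Δ : ℤ) = 4 * a * c - b ^ 2 := ⟨(4 * a * c - b ^ 2).toNat, Int.toNat_of_nonneg hΔ.le⟩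
  have hΔ0 : 0 < Δ := by rw [← hΔd] at hΔ; exact_mod_cast hΔ
  set g : ℤ := 4 * a * f - 2 * b * e with hg
  obtain ⟨M, hMd⟩ : ∃ M : ℕ, (M : ℤ) = g ^ 2 + 4 * Δ * e ^ 2 :=
    ⟨(g ^ 2 + 4 * Δ * e ^ 2).toNat, Int.toNat_of_nonneg (by positivity)⟩
  set T := S.image (fun z : ℤ × ℤ => (2 * (Δ : ℤ) * z.2 + g, 2 * (2 * a * z.1 + b * z.2 + e))) with hT
  have hcard : S.card = T.card := by
    rw [hT, Finset.card_image_of_injective]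
    intro z z' h
    simp only [Prod.mk.injEq] at h
    have hΔZ : (2 * (Δ : ℤ)) ≠ 0 := by positivity
    have h2 : z.2 = z'.2 := mul_left_cancel₀ hΔZ (by linarith [h.1])
    have h1 : z.1 = z'.1 := by
      have h3 := h.2
      rw [h2] at h3
      exact mul_left_cancel₀ (mul_ne_zero two_ne_zero ha0) (by linarith)
    exact Prod.ext h1 h2
  have hTs : ∀ z ∈ T, z.1 ^ 2 + (Δ : ℤ) * z.2 ^ 2 = M := by
    intro w hw
    obtain ⟨z, hz, rfl⟩ := Finset.mem_image.mp hw
    have := hS z hz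
    simp only
    rw [hMd, hg, hΔd]
    linear_combination (16 * a * (4 * a * c - b ^ 2)) * this
  rw [hcard]
  rcases Nat.eq_zero_or_pos M with hM0 | hM0
  · have : T.card ≤ 1 := by
      rw [Finset.card_le_one]
      have key : ∀ z ∈ T, z = (0, 0) := by
        intro z hz
        have h := hTs z hz
        rw [hM0] at h
        have h1 : z.1 ^ 2 = 0 := by
          have : 0 ≤ (Δ : ℤ) * z.2 ^ 2 := by positivity
          push_cast at h
          nlinarith [sq_nonneg z.1]
        have h2 : (Δ : ℤ) * z.2 ^ 2 = 0 := by rw [h1] at h; simpa using h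
        have h3 : z.2 ^ 2 = 0 := by
          rcases mul_eq_zero.mp h2 with h | h
          · exfalso; have : (Δ : ℤ) ≠ 0 := by positivity
            exact this h
          · exact h
        exact Prod.ext (by simpa using h1) (by simpa using h3)
      intro z hz z' hz'
      rw [key z hz, key z' hz']
    have h1 : (T.card : ℝ) ≤ 1 := by exact_mod_cast this
    nlinarith
  · have h1 := aux_norm_card hM0 hΔ0 T hTs
    have h2 := hdiv M hM0
    have hMB : (M : ℤ) ≤ 56 * (B : ℤ) ^ 4 := by
      have mulb : ∀ x y : ℤ, |x| ≤ B → |y| ≤ B → |x * y| ≤ (B : ℤ) ^ 2 := by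
        intro x y hx hy
        rw [abs_mul, sq]
        exact mul_le_mul hx hy (abs_nonneg _) (by positivity)
      have i1 := abs_le.mp (mulb a f ha hf)
      have i2 := abs_le.mp (mulb b e hb he)
      have i3 := abs_le.mp (mulb a c ha hc)
      have i4 := abs_le.mp (mulb e e he he)
      have hg1 : |g| ≤ 6 * (B : ℤ) ^ 2 := by
        rw [abs_le]; constructor <;> · rw [hg]; linarith [i1.1, i1.2, i2.1, i2.2]
      have hg2 : g ^ 2 ≤ (6 * (B : ℤ) ^ 2) ^ 2 := sq_le_sq' (abs_le.mp hg1).1 (abs_le.mp hg1).2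
      have hD : (Δ : ℤ) ≤ 4 * (B : ℤ) ^ 2 := by rw [hΔd]; nlinarith [sq_nonneg b]
      have hDe : (Δ : ℤ) * e ^ 2 ≤ (4 * (B : ℤ) ^ 2) * (B : ℤ) ^ 2 :=
        mul_le_mul hD (by linarith [i4.2]) (sq_nonneg _) (by positivity)
      rw [hMd]
      nlinarith [show (0 : ℤ) ≤ (B : ℤ) ^ 4 by positivity]
    have hMR : (M : ℝ) ≤ 56 * (B : ℝ) ^ 4 := by exact_mod_cast hMB
    have h3 : (M : ℝ) ^ (ε / 8) ≤ (56 * (B : ℝ) ^ 4) ^ (ε / 8) :=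
      Real.rpow_le_rpow (by positivity) hMR (by positivity)
    have h4 : ((Nat.divisors M).card : ℝ) ≤ C₁ * (56 * (B : ℝ) ^ 4) ^ (ε / 8) :=
      h2.trans (mul_le_mul_of_nonneg_left h3 (by linarith))
    have h5 : ((56 * (B : ℝ) ^ 4) ^ (ε / 8)) ^ 2 = (56 : ℝ) ^ (ε / 4) * (B : ℝ) ^ ε := by
      rw [← Real.rpow_natCast, ← Real.rpow_mul (by positivity), Real.mul_rpow (by norm_num) (by positivity),
        ← Real.rpow_natCast (B : ℝ) 4, ← Real.rpow_mul (by positivity)]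
      push_cast
      congr 2 <;> ring
    have h6 : (T.card : ℝ) ≤ 8 * ((Nat.divisors M).card : ℝ) * (Nat.divisors M).card := by exact_mod_cast h1
    calc (T.card : ℝ) ≤ 8 * ((Nat.divisors M).card : ℝ) * (Nat.divisors M).card := h6
      _ = 8 * ((Nat.divisors M).card : ℝ) ^ 2 := by ring
      _ ≤ 8 * (C₁ * (56 * (B : ℝ) ^ 4) ^ (ε / 8)) ^ 2 := by gcongr
      _ = _ := by rw [mul_pow, h5]; ring

set_option maxHeartbeats 800000 in
theorem aux_circle_ijkl (ε : ℝ) (hε : 0 < ε) : ∃ C : ℝ, 1 ≤ C ∧ ∀ B : ℕ, 1 ≤ B →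
    ∀ n n' : Fin 4 → ℤ, (∀ t, |n t| ≤ B) → (∀ t, |n' t| ≤ B) → ∀ m N N' : ℤ,
    ∀ i j k l : Fin 4, (∀ t, t = i ∨ t = j ∨ t = k ∨ t = l) →
    (∀ F : Fin 4 → ℤ, ∑ t, F t = F i + F j + F k + F l) → n i * n' j - n j * n' i ≠ 0 →
    ∀ S : Finset (Fin 4 → ℤ), (∀ x ∈ S, (∀ t, |x t| ≤ B) ∧ ∑ t, x t ^ 2 = m ∧
      ∑ t, x t * n t = N ∧ ∑ t, x t * n' t = N') →
    (S.card : ℝ) ≤ C * (B : ℝ) ^ ε := by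
  obtain ⟨C, hC, H⟩ := aux_conic (ε / 5) (by positivity)
  have h24 : (1 : ℝ) ≤ (24 : ℝ) ^ (ε / 5) := Real.one_le_rpow (by norm_num) (by positivity)
  refine ⟨C * (24 : ℝ) ^ (ε / 5), by nlinarith, ?_⟩
  intro B hB n n' hn hn' m N N' i j k l hcov hsum hδ S hS
  have hBZ : (1 : ℤ) ≤ B := by exact_mod_cast hB
  have hBR : (1 : ℝ) ≤ B := by exact_mod_cast hB
  have hrhs : C * (24 : ℝ) ^ (ε / 5) * (B : ℝ) ^ ε = C * ((24 * B ^ 5 : ℕ) : ℝ) ^ (ε / 5) := by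
    push_cast
    rw [Real.mul_rpow (by norm_num) (by positivity), ← Real.rpow_natCast (B : ℝ) 5,
      ← Real.rpow_mul (by positivity)]
    have : ((5 : ℕ) : ℝ) * (ε / 5) = ε := by push_cast; ring
    rw [this]; ring
  rw [hrhs]
  rcases S.eq_empty_or_nonempty with rfl | ⟨x0, hx0⟩
  · simp only [Finset.card_empty, Nat.cast_zero]; positivity
  obtain ⟨δ, hδd⟩ : ∃ δ : ℤ, δ = n i * n' j - n j * n' i := ⟨_, rfl⟩
  rw [← hδd] at hδ
  obtain ⟨pk, hpk⟩ : ∃ pk : ℤ, pk = n j * n' k - n k * n' j := ⟨_, rfl⟩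
  obtain ⟨pl, hpl⟩ : ∃ pl : ℤ, pl = n j * n' l - n l * n' j := ⟨_, rfl⟩
  obtain ⟨qk, hqk⟩ : ∃ qk : ℤ, qk = n k * n' i - n i * n' k := ⟨_, rfl⟩
  obtain ⟨ql, hql⟩ : ∃ ql : ℤ, ql = n l * n' i - n i * n' l := ⟨_, rfl⟩
  obtain ⟨hb0, hm0, hN0, hN0'⟩ := hS x0 hx0
  rw [hsum] at hm0 hN0 hN0'
  have hlin : ∀ x ∈ S, δ * (x i - x0 i) = pk * (x k - x0 k) + pl * (x l - x0 l) ∧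
      δ * (x j - x0 j) = qk * (x k - x0 k) + ql * (x l - x0 l) := by
    intro x hx
    obtain ⟨-, -, h1, h2⟩ := hS x hx
    rw [hsum] at h1 h2
    constructor
    · rw [hδd, hpk, hpl]
      linear_combination n' j * (h1 - hN0) - n j * (h2 - hN0')
    · rw [hδd, hqk, hql]
      linear_combination n i * (h2 - hN0') - n' i * (h1 - hN0)
  have hcard : S.card = (S.image (fun x => (x k - x0 k, x l - x0 l))).card := by
    rw [Finset.card_image_of_injOn]
    intro x hx y hy hxy
    simp only [Prod.mk.injEq] at hxy
    obtain ⟨a1, a2⟩ := hlin x hx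
    obtain ⟨b1, b2⟩ := hlin y hy
    rw [hxy.1, hxy.2] at a1 a2
    have c1 : x i = y i := by
      have := mul_left_cancel₀ hδ (a1.trans b1.symm); linarith
    have c2 : x j = y j := by
      have := mul_left_cancel₀ hδ (a2.trans b2.symm); linarith
    funext t
    rcases hcov t with rfl | rfl | rfl | rfl
    · exact c1
    · exact c2
    · linarith [hxy.1]
    · linarith [hxy.2]
  rw [hcard]
  have mulb : ∀ (P Q : ℤ) (x y : ℤ), |x| ≤ P → |y| ≤ Q → |x * y| ≤ P * Q := by
    intro P Q x y hx hy
    rw [abs_mul]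
    exact mul_le_mul hx hy (abs_nonneg _) ((abs_nonneg _).trans hx)
  have minor : ∀ s t : Fin 4, |n s * n' t - n t * n' s| ≤ 2 * (B : ℤ) ^ 2 := by
    intro s t
    have a1 := abs_le.mp (mulb B B _ _ (hn s) (hn' t))
    have a2 := abs_le.mp (mulb B B _ _ (hn t) (hn' s))
    rw [abs_le]; constructor <;> nlinarith [a1.1, a1.2, a2.1, a2.2]
  have bδ : |δ| ≤ 2 * (B : ℤ) ^ 2 := by rw [hδd]; exact minor i j
  have bpk : |pk| ≤ 2 * (B : ℤ) ^ 2 := by rw [hpk]; exact minor j k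
  have bpl : |pl| ≤ 2 * (B : ℤ) ^ 2 := by rw [hpl]; exact minor j l
  have bqk : |qk| ≤ 2 * (B : ℤ) ^ 2 := by rw [hqk]; exact minor k i
  have bql : |ql| ≤ 2 * (B : ℤ) ^ 2 := by rw [hql]; exact minor l i
  have hB45 : (B : ℤ) ^ 4 ≤ (B : ℤ) ^ 5 := pow_le_pow_right₀ hBZ (by norm_num)
  have hB5 : (0 : ℤ) ≤ (B : ℤ) ^ 5 := by positivity
  have e4 : (2 * (B : ℤ) ^ 2) * (2 * (B : ℤ) ^ 2) = 4 * (B : ℤ) ^ 4 := by ring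
  have e5 : (4 * (B : ℤ) ^ 4) * (B : ℤ) = 4 * (B : ℤ) ^ 5 := by ring
  have two : ∀ x y : ℤ, |x| ≤ 2 * (B : ℤ) ^ 2 → |y| ≤ 2 * (B : ℤ) ^ 2 →
      -(4 * (B : ℤ) ^ 4) ≤ x * y ∧ x * y ≤ 4 * (B : ℤ) ^ 4 := by
    intro x y hx hy
    have := mulb _ _ x y hx hy
    rw [e4] at this
    exact abs_le.mp this
  have three : ∀ x y z : ℤ, |x| ≤ 2 * (B : ℤ) ^ 2 → |y| ≤ 2 * (B : ℤ) ^ 2 → |z| ≤ B →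
      -(4 * (B : ℤ) ^ 5) ≤ x * y * z ∧ x * y * z ≤ 4 * (B : ℤ) ^ 5 := by
    intro x y z hx hy hz
    have := mulb _ _ (x * y) z (mulb _ _ x y hx hy) hz
    rw [e4, e5] at this
    exact abs_le.mp this
  have quad : ∀ x y z : ℤ, |x| ≤ 2 * (B : ℤ) ^ 2 → |y| ≤ 2 * (B : ℤ) ^ 2 → |z| ≤ 2 * (B : ℤ) ^ 2 →
      |x ^ 2 + y ^ 2 + z ^ 2| ≤ ((24 * B ^ 5 : ℕ) : ℤ) := by
    intro x y z hx hy hz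
    push_cast
    have a1 := two x x hx hx
    have a2 := two y y hy hy
    have a3 := two z z hz hz
    rw [abs_le]; constructor <;> nlinarith [a1.1, a1.2, a2.1, a2.2, a3.1, a3.2]
  have lind : ∀ p q : ℤ, ∀ s : Fin 4, |p| ≤ 2 * (B : ℤ) ^ 2 → |q| ≤ 2 * (B : ℤ) ^ 2 →
      |2 * (δ * p * x0 i) + 2 * (δ * q * x0 j) + 2 * (δ * δ * x0 s)| ≤ ((24 * B ^ 5 : ℕ) : ℤ) := by
    intro p q s hp hq
    push_cast
    have a1 := three δ p (x0 i) bδ hp (hb0 i)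
    have a2 := three δ q (x0 j) bδ hq (hb0 j)
    have a3 := three δ δ (x0 s) bδ bδ (hb0 s)
    rw [abs_le]; constructor <;> linarith [a1.1, a1.2, a2.1, a2.2, a3.1, a3.2]
  apply H (24 * B ^ 5) (Nat.mul_pos (by norm_num) (pow_pos hB 5))
    (pk ^ 2 + qk ^ 2 + δ ^ 2) (2 * (pk * pl + qk * ql)) (pl ^ 2 + ql ^ 2 + δ ^ 2)
    (2 * (δ * pk * x0 i) + 2 * (δ * qk * x0 j) + 2 * (δ * δ * x0 k))
    (2 * (δ * pl * x0 i) + 2 * (δ * ql * x0 j) + 2 * (δ * δ * x0 l))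
    (quad _ _ _ bpk bqk bδ) ?_ (quad _ _ _ bpl bql bδ) (lind _ _ _ bpk bqk) (lind _ _ _ bpl bql) ?_
  · intro w hw
    obtain ⟨x, hx, rfl⟩ := Finset.mem_image.mp hw
    obtain ⟨a1, a2⟩ := hlin x hx
    obtain ⟨-, h1, -, -⟩ := hS x hx
    rw [hsum] at h1
    simp only
    generalize hP : pk * (x k - x0 k) + pl * (x l - x0 l) = P at a1
    generalize hQ : qk * (x k - x0 k) + ql * (x l - x0 l) = Q at a2
    have : P ^ 2 + Q ^ 2 + δ ^ 2 * ((x k - x0 k) ^ 2 + (x l - x0 l) ^ 2)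
        + 2 * δ * (x0 i * P + x0 j * Q) + 2 * δ ^ 2 * (x0 k * (x k - x0 k) + x0 l * (x l - x0 l)) = 0 := by
      rw [← a1, ← a2]
      linear_combination δ ^ 2 * (h1 - hm0)
    rw [← hP, ← hQ] at this
    linear_combination this
  · push_cast
    have a1 := two pk pl bpk bpl
    have a2 := two qk ql bqk bql
    rw [abs_le]; constructor <;> linarith [a1.1, a1.2, a2.1, a2.2]
  · have : 0 < δ ^ 2 := by positivity
    have : 0 < δ ^ 2 * δ ^ 2 := by positivity
    nlinarith [sq_nonneg (pk * ql - pl * qk), mul_nonneg (sq_nonneg δ) (sq_nonneg pk), mul_nonneg (sq_nonneg δ) (sq_nonneg qk), mul_nonneg (sq_nonneg δ) (sq_nonneg pl), mul_nonneg (sq_nonneg δ) (sq_nonneg ql)]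

theorem aux_fin4 : ∀ i j : Fin 4, i ≠ j → ∃ k l : Fin 4, (∀ t, t = i ∨ t = j ∨ t = k ∨ t = l) ∧
    i ≠ k ∧ i ≠ l ∧ j ≠ k ∧ j ≠ l ∧ k ≠ l := by decide

theorem aux_fin4_sum {i j k l : Fin 4} (hcov : ∀ t, t = i ∨ t = j ∨ t = k ∨ t = l)
    (hij : i ≠ j) (hik : i ≠ k) (hil : i ≠ l) (hjk : j ≠ k) (hjl : j ≠ l) (hkl : k ≠ l)
    (F : Fin 4 → ℤ) : ∑ t, F t = F i + F j + F k + F l := by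
  have : (Finset.univ : Finset (Fin 4)) = {i, j, k, l} := by
    ext t; simpa using hcov t
  rw [this, Finset.sum_insert (by simp [hij, hik, hil]), Finset.sum_insert (by simp [hjk, hjl]),
    Finset.sum_insert (by simp [hkl]), Finset.sum_singleton]
  ring

theorem aux_circle (ε : ℝ) (hε : 0 < ε) : ∃ C : ℝ, 1 ≤ C ∧ ∀ m : ℕ, 1 ≤ m →
    ∀ n n' : Fin 4 → ℤ, n ≠ 0 → n' ≠ 0 → n ≠ n' → (∀ t, |n t| ≤ 2 * m) → (∀ t, |n' t| ≤ 2 * m) →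
    ∀ S : Finset (Fin 4 → ℤ), (∀ x ∈ S, ∑ t, x t ^ 2 = (m : ℤ) ∧
      2 * ∑ t, x t * n t = ∑ t, n t ^ 2 ∧ 2 * ∑ t, x t * n' t = ∑ t, n' t ^ 2) →
    (S.card : ℝ) ≤ C * (m : ℝ) ^ ε := by
  obtain ⟨C, hC, H⟩ := aux_circle_ijkl ε hε
  have h2 : (1 : ℝ) ≤ (2 : ℝ) ^ ε := Real.one_le_rpow (by norm_num) hε.le
  refine ⟨C * (2 : ℝ) ^ ε, by nlinarith, ?_⟩
  intro m hm n n' hn0 hn0' hne hn hn' S hS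
  have hrhs : C * (2 : ℝ) ^ ε * (m : ℝ) ^ ε = C * ((2 * m : ℕ) : ℝ) ^ ε := by
    push_cast
    rw [Real.mul_rpow (by norm_num) (by positivity)]; ring
  rw [hrhs]
  rcases S.eq_empty_or_nonempty with rfl | ⟨x, hx⟩
  · simp only [Finset.card_empty, Nat.cast_zero]; positivity
  by_cases hmin : ∃ i j, n i * n' j - n j * n' i ≠ 0
  · obtain ⟨i, j, hδ⟩ := hmin
    have hij : i ≠ j := by rintro rfl; apply hδ; ring
    obtain ⟨k, l, hcov, a1, a2, a3, a4, a5⟩ := aux_fin4 i j hij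
    have hsum := aux_fin4_sum hcov hij a1 a2 a3 a4 a5
    have hpar : ∀ v : Fin 4 → ℤ, ∀ y ∈ S, 2 * ∑ t, y t * v t = ∑ t, v t ^ 2 →
        ∑ t, y t * v t = (∑ t, v t ^ 2) / 2 := by
      intro v y _ h; omega
    apply H (2 * m) (by omega) n n' (by simpa using hn) (by simpa using hn') m
      ((∑ t, n t ^ 2) / 2) ((∑ t, n' t ^ 2) / 2) i j k l hcov hsum hδ S
    intro y hy
    obtain ⟨b1, b2, b3⟩ := hS y hy
    refine ⟨?_, b1, hpar n y hy b2, hpar n' y hy b3⟩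
    intro t
    have h1 : y t ^ 2 ≤ m := by
      rw [← b1]
      exact Finset.single_le_sum (f := fun t => y t ^ 2) (fun i _ => sq_nonneg (y i)) (Finset.mem_univ t)
    have h3 : |y t| ≤ y t ^ 2 := by
      rw [← sq_abs]
      have := abs_nonneg (y t)
      rcases eq_or_lt_of_le this with h | h
      · rw [← h]; norm_num
      · nlinarith
    push_cast
    linarith
  · exfalso
    push Not at hmin
    obtain ⟨-, b2, b3⟩ := hS x hx
    simp only [Fin.sum_univ_four] at b2 b3
    have key1 : ∀ i, n i * (∑ t, n' t ^ 2) = n' i * (∑ t, n t ^ 2) := by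
      intro i
      simp only [Fin.sum_univ_four]
      rw [← b2, ← b3]
      linear_combination 2 * x 0 * hmin i 0 + 2 * x 1 * hmin i 1 + 2 * x 2 * hmin i 2 + 2 * x 3 * hmin i 3
    have pos : ∀ v : Fin 4 → ℤ, v ≠ 0 → ∑ t, v t ^ 2 ≠ 0 := by
      intro v hv h
      apply hv
      funext t
      have := (Finset.sum_eq_zero_iff_of_nonneg (fun i _ => sq_nonneg (v i))).mp h t (Finset.mem_univ t)
      simpa using this
    set D := n 0 * n' 0 + n 1 * n' 1 + n 2 * n' 2 + n 3 * n' 3 with hD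
    have e1 : ∑ t, n' t ^ 2 = D := by
      apply mul_left_cancel₀ (pos n hn0)
      have := key1 0; have := key1 1; have := key1 2; have := key1 3
      simp only [Fin.sum_univ_four] at *
      rw [hD]
      linear_combination n 0 * key1 0 + n 1 * key1 1 + n 2 * key1 2 + n 3 * key1 3
    have e2 : ∑ t, n t ^ 2 = D := by
      apply mul_left_cancel₀ (pos n' hn0')
      simp only [Fin.sum_univ_four] at *
      rw [hD]
      linear_combination -(n' 0 * key1 0 + n' 1 * key1 1 + n' 2 * key1 2 + n' 3 * key1 3)
    have : n - n' = 0 := by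
      by_contra h
      apply pos _ h
      simp only [Fin.sum_univ_four, Pi.sub_apply] at *
      linear_combination e1 + e2
    exact hne (sub_eq_zero.mp this)

theorem aux_kst {α β : Type*} [DecidableEq α] (Y : Finset β) (U : Finset α) (X : β → Finset α)
    (K : ℝ) (hK0 : 0 ≤ K) (hX : ∀ y ∈ Y, X y ⊆ U)
    (hK : ∀ y ∈ Y, ∀ y' ∈ Y, y ≠ y' → ((X y ∩ X y').card : ℝ) ≤ K) :
    (∑ y ∈ Y, ((X y).card : ℝ)) ^ 2 ≤ U.card * ((∑ y ∈ Y, ((X y).card : ℝ)) + K * (Y.card : ℝ) ^ 2) := by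
  classical
  have hc : ∀ y ∈ Y, ((X y).card : ℝ) = ∑ u ∈ U, if u ∈ X y then (1 : ℝ) else 0 := by
    intro y hy
    rw [Finset.sum_ite_mem, Finset.inter_eq_right.mpr (hX y hy)]
    simp
  have h1 : ∑ y ∈ Y, ((X y).card : ℝ) = ∑ u ∈ U, ∑ y ∈ Y, if u ∈ X y then (1 : ℝ) else 0 := by
    rw [Finset.sum_comm]
    exact Finset.sum_congr rfl hc
  have h2 : (∑ u ∈ U, ∑ y ∈ Y, if u ∈ X y then (1 : ℝ) else 0) ^ 2 ≤
      U.card * ∑ u ∈ U, (∑ y ∈ Y, if u ∈ X y then (1 : ℝ) else 0) ^ 2 := sq_sum_le_card_mul_sum_sq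
  have h3 : ∑ u ∈ U, (∑ y ∈ Y, if u ∈ X y then (1 : ℝ) else 0) ^ 2 =
      ∑ y ∈ Y, ∑ y' ∈ Y, ((X y ∩ X y').card : ℝ) := by
    have : ∀ u ∈ U, (∑ y ∈ Y, if u ∈ X y then (1 : ℝ) else 0) ^ 2 =
        ∑ y ∈ Y, ∑ y' ∈ Y, if u ∈ X y ∩ X y' then (1 : ℝ) else 0 := by
      intro u _
      rw [sq, Finset.sum_mul_sum]
      refine Finset.sum_congr rfl fun y _ => Finset.sum_congr rfl fun y' _ => ?_
      by_cases a : u ∈ X y <;> by_cases b : u ∈ X y' <;> simp [a, b]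
    rw [Finset.sum_congr rfl this, Finset.sum_comm]
    refine Finset.sum_congr rfl fun y hy => ?_
    rw [Finset.sum_comm]
    refine Finset.sum_congr rfl fun y' _ => ?_
    rw [Finset.sum_ite_mem, Finset.inter_eq_right.mpr (Finset.inter_subset_left.trans (hX y hy))]
    simp
  have h4 : ∑ y ∈ Y, ∑ y' ∈ Y, ((X y ∩ X y').card : ℝ) ≤
      (∑ y ∈ Y, ((X y).card : ℝ)) + K * (Y.card : ℝ) ^ 2 := by
    have : ∀ y ∈ Y, ∑ y' ∈ Y, ((X y ∩ X y').card : ℝ) ≤ (X y).card + K * Y.card := by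
      intro y hy
      calc ∑ y' ∈ Y, ((X y ∩ X y').card : ℝ) ≤ ∑ y' ∈ Y, ((if y = y' then ((X y).card : ℝ) else 0) + K) := by
            refine Finset.sum_le_sum fun y' hy' => ?_
            by_cases h : y = y'
            · subst h; simp [hK0]
            · simp only [h, if_false, zero_add]; exact hK y hy y' hy' h
        _ = (X y).card + K * Y.card := by
            rw [Finset.sum_add_distrib, Finset.sum_ite_eq, if_pos hy]
            simp [mul_comm]
    calc _ ≤ ∑ y ∈ Y, (((X y).card : ℝ) + K * Y.card) := Finset.sum_le_sum this
      _ = _ := by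
        rw [Finset.sum_add_distrib]
        simp only [Finset.sum_const, nsmul_eq_mul]
        ring
  rw [h1] at h4 ⊢
  calc _ ≤ _ := h2
    _ ≤ _ := by
      rw [h3]
      exact mul_le_mul_of_nonneg_left h4 (by positivity)

theorem aux_hit {α β : Type*} [DecidableEq α] (A : Finset α) (D : ℝ) (hD : 0 < D)
    (Ω : Finset β) (X : β → Finset α) (hX : ∀ ω ∈ Ω, X ω ⊆ A) (hc : ∀ ω ∈ Ω, D ≤ (X ω).card) :
    ∃ R ⊆ A, (R.card : ℝ) ≤ (A.card / D) * Real.log Ω.card + 1 ∧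
      ∀ ω ∈ Ω, ∃ a ∈ R, a ∈ X ω := by
  classical
  rcases Ω.eq_empty_or_nonempty with rfl | hΩ
  · exact ⟨∅, by simp, by simp, by simp⟩
  have hPD : D ≤ A.card := by
    obtain ⟨ω, hω⟩ := hΩ
    exact (hc ω hω).trans (by exact_mod_cast Finset.card_le_card (hX ω hω))
  have hP : (0 : ℝ) < A.card := hD.trans_le hPD
  have step : ∀ k : ℕ, ∃ R ⊆ A, R.card ≤ k ∧
      ((Ω.filter (fun ω => ∀ a ∈ R, a ∉ X ω)).card : ℝ) ≤ Ω.card * (1 - D / A.card) ^ k := by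
    intro k
    induction k with
    | zero => exact ⟨∅, by simp, by simp, by simp⟩
    | succ k ih =>
      obtain ⟨R, hRA, hRk, hun⟩ := ih
      set U := Ω.filter (fun ω => ∀ a ∈ R, a ∉ X ω) with hU
      have hs : ∑ a ∈ A, (D / A.card * U.card) ≤ ∑ a ∈ A, ((U.filter (fun ω => a ∈ X ω)).card : ℝ) := by
        have e1 : ∑ a ∈ A, ((U.filter (fun ω => a ∈ X ω)).card : ℝ) = ∑ ω ∈ U, ((X ω).card : ℝ) := by
          have : ∀ a ∈ A, ((U.filter (fun ω => a ∈ X ω)).card : ℝ) = ∑ ω ∈ U, if a ∈ X ω then (1 : ℝ) else 0 := by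
            intro a _
            rw [Finset.card_filter]; push_cast; rfl
          rw [Finset.sum_congr rfl this, Finset.sum_comm]
          refine Finset.sum_congr rfl fun ω hω => ?_
          rw [Finset.sum_ite_mem, Finset.inter_eq_right.mpr (hX ω (Finset.mem_filter.mp hω).1)]
          simp
        rw [e1]
        calc ∑ a ∈ A, (D / A.card * U.card) = ∑ ω ∈ U, D := by
              simp only [Finset.sum_const, nsmul_eq_mul]
              field_simp
          _ ≤ _ := Finset.sum_le_sum fun ω hω => hc ω (Finset.mem_filter.mp hω).1
      have hAne : A.Nonempty := by
        rw [← Finset.card_pos]; exact_mod_cast hP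
      obtain ⟨a, haA, ha⟩ := Finset.exists_le_of_sum_le hAne hs
      refine ⟨insert a R, Finset.insert_subset haA hRA, (Finset.card_insert_le _ _).trans (by omega), ?_⟩
      have e2 : Ω.filter (fun ω => ∀ b ∈ insert a R, b ∉ X ω) = U.filter (fun ω => ¬ a ∈ X ω) := by
        ext ω
        simp only [hU, Finset.mem_filter, Finset.mem_insert, forall_eq_or_imp]
        tauto
      rw [e2]
      have e3 := Finset.card_filter_add_card_filter_not (s := U) (fun ω => a ∈ X ω)
      have e4 : ((U.filter (fun ω => a ∈ X ω)).card : ℝ) + ((U.filter (fun ω => ¬ a ∈ X ω)).card : ℝ) = U.card := by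
        exact_mod_cast e3
      have hr : 0 ≤ 1 - D / A.card := by
        rw [sub_nonneg, div_le_one hP]; exact hPD
      calc ((U.filter (fun ω => ¬ a ∈ X ω)).card : ℝ) ≤ U.card * (1 - D / A.card) := by nlinarith
        _ ≤ (Ω.card * (1 - D / A.card) ^ k) * (1 - D / A.card) := mul_le_mul_of_nonneg_right hun hr
        _ = _ := by ring
  have hΩp : (0 : ℝ) < Ω.card := by exact_mod_cast Finset.card_pos.mpr hΩ
  have hΩ1 : (1 : ℝ) ≤ Ω.card := by exact_mod_cast Finset.card_pos.mpr hΩ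
  have hlog := Real.log_nonneg hΩ1
  obtain ⟨R, hRA, hRk, hun⟩ := step (⌊(A.card / D) * Real.log Ω.card⌋₊ + 1)
  set k := ⌊(A.card / D) * Real.log Ω.card⌋₊ + 1 with hk
  have hk1 : (A.card / D) * Real.log Ω.card < k := by
    rw [hk]; push_cast; exact Nat.lt_floor_add_one _
  have hk2 : (k : ℝ) ≤ (A.card / D) * Real.log Ω.card + 1 := by
    rw [hk]; push_cast
    have := Nat.floor_le (a := (A.card / D) * Real.log Ω.card) (by positivity)
    linarith
  refine ⟨R, hRA, le_trans (by exact_mod_cast hRk) hk2, ?_⟩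
  have hlt : (Ω.card : ℝ) * (1 - D / A.card) ^ k < 1 := by
    have hr : 0 ≤ 1 - D / A.card := by
      rw [sub_nonneg, div_le_one hP]; exact hPD
    have h1 : 1 - D / A.card ≤ Real.exp (-(D / A.card)) := by
      have := Real.add_one_le_exp (-(D / A.card)); linarith
    have h2 : (1 - D / A.card) ^ k ≤ Real.exp (-(D / A.card)) ^ k := pow_le_pow_left₀ hr h1 k
    rw [← Real.exp_nat_mul] at h2
    have h3 : Real.log Ω.card < k * (D / A.card) := by
      have := mul_lt_mul_of_pos_right hk1 (show 0 < D / A.card by positivity)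
      have e : A.card / D * Real.log Ω.card * (D / A.card) = Real.log Ω.card := by field_simp
      rwa [e] at this
    calc (Ω.card : ℝ) * (1 - D / A.card) ^ k ≤ Ω.card * Real.exp (k * -(D / A.card)) := by gcongr
      _ = Real.exp (Real.log Ω.card + k * -(D / A.card)) := by
        rw [Real.exp_add, Real.exp_log hΩp]
      _ < 1 := by rw [Real.exp_lt_one_iff]; linarith
  have h0 : (Ω.filter (fun ω => ∀ a ∈ R, a ∉ X ω)).card = 0 := by
    have := hun.trans_lt hlt
    have : (Ω.filter (fun ω => ∀ a ∈ R, a ∉ X ω)).card < 1 := by exact_mod_cast this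
    omega
  rw [Finset.card_eq_zero, Finset.filter_eq_empty_iff] at h0
  intro ω hω
  have := h0 hω
  push Not at this
  exact this

theorem aux_signs_fin : ∀ (q : ℕ) (V : Type) [AddCommGroup V] [Module ℝ V] [FiniteDimensional ℝ V]
    (ℓ : Fin q → V →ₗ[ℝ] ℝ) (c : Fin q → ℝ),
    (Set.range (fun (v : V) (i : Fin q) => SignType.sign (ℓ i v + c i))).ncard ≤
      (2 * q + 1) ^ (Module.finrank ℝ V) := by
  intro q
  induction q with
  | zero =>
    intro V _ _ _ ℓ c
    have : (Set.range (fun (v : V) (i : Fin 0) => SignType.sign (ℓ i v + c i))).ncard ≤ 1 := by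
      rw [Set.ncard_le_one]
      intro a _ b _
      exact Subsingleton.elim a b
    simpa using this
  | succ q ih =>
    intro V _ _ _ ℓ c
    set f : Fin (q + 1) → V → ℝ := fun i v => ℓ i v + c i with hf
    set R := Set.range (fun (v : V) (i : Fin (q + 1)) => SignType.sign (ℓ i v + c i)) with hR
    set R' := Set.range (fun (v : V) (i : Fin q) => SignType.sign (ℓ i.castSucc v + c i.castSucc)) with hR'
    have hR'c : R'.ncard ≤ (2 * q + 1) ^ (Module.finrank ℝ V) :=
      ih V (fun i => ℓ i.castSucc) (fun i => c i.castSucc)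
    by_cases hl : ℓ (Fin.last q) = 0
    · have h1 : R.ncard ≤ R'.ncard := by
        apply Set.ncard_le_ncard_of_injOn (fun s (i : Fin q) => s i.castSucc)
        · rintro s ⟨v, rfl⟩
          exact ⟨v, rfl⟩
        · rintro s ⟨v, rfl⟩ s' ⟨v', rfl⟩ h
          funext i
          refine Fin.lastCases ?_ (fun i => ?_) i
          · simp [hl]
          · exact congrFun h i
      calc R.ncard ≤ (2 * q + 1) ^ (Module.finrank ℝ V) := h1.trans hR'c
        _ ≤ _ := Nat.pow_le_pow_left (by omega) _
    · set T : SignType → Set (Fin q → SignType) := fun s =>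
        (fun (v : V) (i : Fin q) => SignType.sign (ℓ i.castSucc v + c i.castSucc)) ''
          {v | SignType.sign (ℓ (Fin.last q) v + c (Fin.last q)) = s} with hT
      have hTR : ∀ s, T s ⊆ R' := by
        intro s; rintro _ ⟨v, _, rfl⟩; exact ⟨v, rfl⟩
      have hRT : R ⊆ ((fun t : Fin q → SignType => (Fin.snoc t 0 : Fin (q + 1) → SignType)) '' T 0) ∪
          (((fun t : Fin q → SignType => (Fin.snoc t 1 : Fin (q + 1) → SignType)) '' T 1) ∪
          ((fun t : Fin q → SignType => (Fin.snoc t (-1) : Fin (q + 1) → SignType)) '' T (-1))) := by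
        rintro _ ⟨v, rfl⟩
        have hsn : ∀ s, SignType.sign (ℓ (Fin.last q) v + c (Fin.last q)) = s →
            (fun i : Fin (q + 1) => SignType.sign (ℓ i v + c i)) ∈
            ((fun t : Fin q → SignType => (Fin.snoc t s : Fin (q + 1) → SignType)) '' T s) := by
          intro s hs
          refine ⟨_, ⟨v, hs, rfl⟩, ?_⟩
          funext i
          refine Fin.lastCases ?_ (fun i => ?_) i
          · simp [hs]
          · simp
        rcases h : SignType.sign (ℓ (Fin.last q) v + c (Fin.last q)) with _ | _ | _
        · exact Or.inl (hsn _ h)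
        · exact Or.inr (Or.inr (hsn _ h))
        · exact Or.inr (Or.inl (hsn _ h))
      have himg : ∀ s : SignType, ((fun t : Fin q → SignType => (Fin.snoc t s : Fin (q + 1) → SignType)) '' T s).ncard
          ≤ (T s).ncard := fun s => Set.ncard_image_le (Set.toFinite _)
      have hTint : T 1 ∩ T (-1) ⊆ T 0 := by
        rintro t ⟨⟨v, hv, rfl⟩, ⟨w, hw, hvw⟩⟩
        simp only [Set.mem_ofPred_eq, sign_eq_one_iff, sign_eq_neg_one_iff] at hv hw
        set a := ℓ (Fin.last q) v + c (Fin.last q) with ha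
        set b := ℓ (Fin.last q) w + c (Fin.last q) with hb
        set p : V := (-b / (a - b)) • v + (a / (a - b)) • w with hp
        have hab : 0 < a - b := by linarith
        have hpf : ∀ i, ℓ i p + c i = (-b / (a - b)) * (ℓ i v + c i) + (a / (a - b)) * (ℓ i w + c i) := by
          intro i
          rw [hp]; simp only [map_add, map_smul, smul_eq_mul]
          field_simp; ring
        have h1 : 0 < -b / (a - b) := div_pos (by linarith) hab
        have h2 : 0 < a / (a - b) := div_pos hv hab
        refine ⟨p, ?_, ?_⟩
        · simp only [Set.mem_ofPred_eq, sign_eq_zero_iff]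
          rw [hpf, ← ha, ← hb]
          field_simp; ring
        · funext i
          have hi := congrFun hvw i
          simp only at hi ⊢
          rw [hpf]
          rcases lt_trichotomy (ℓ i.castSucc v + c i.castSucc) 0 with h | h | h
          · rw [sign_neg h] at hi ⊢
            rw [sign_eq_neg_one_iff] at hi ⊢
            nlinarith
          · rw [h, sign_zero] at hi
            rw [sign_eq_zero_iff] at hi
            rw [h, hi]; simp
          · rw [sign_pos h] at hi ⊢
            rw [sign_eq_one_iff] at hi ⊢
            nlinarith
      have hsum : (T 1).ncard + (T (-1)).ncard ≤ R'.ncard + (T 0).ncard := by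
        rw [← Set.ncard_union_add_ncard_inter (T 1) (T (-1)) (Set.toFinite _) (Set.toFinite _)]
        exact Nat.add_le_add (Set.ncard_le_ncard (Set.union_subset (hTR _) (hTR _)) (Set.toFinite _))
          (Set.ncard_le_ncard hTint (Set.toFinite _))
      have hT0 : (T 0).ncard ≤ (2 * q + 1) ^ (Module.finrank ℝ V - 1) := by
        obtain ⟨u, hu⟩ : ∃ u, ℓ (Fin.last q) u ≠ 0 := by
          by_contra h; push Not at h
          exact hl (LinearMap.ext h)
        set p : V := (-(c (Fin.last q)) / ℓ (Fin.last q) u) • u with hp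
        have hpl : ℓ (Fin.last q) p = -(c (Fin.last q)) := by
          rw [hp]; simp only [map_smul, smul_eq_mul]; field_simp
        have hfr : Module.finrank ℝ (LinearMap.ker (ℓ (Fin.last q))) = Module.finrank ℝ V - 1 := by
          have h1 := LinearMap.finrank_range_add_finrank_ker (ℓ (Fin.last q))
          have h2 : LinearMap.range (ℓ (Fin.last q)) = ⊤ := LinearMap.range_eq_top.mpr (LinearMap.surjective hl)
          rw [h2] at h1
          simp at h1
          omega
        have := ih (LinearMap.ker (ℓ (Fin.last q))) (fun i => (ℓ i.castSucc).comp (LinearMap.ker (ℓ (Fin.last q))).subtype)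
          (fun i => ℓ i.castSucc p + c i.castSucc)
        rw [hfr] at this
        refine le_trans (Set.ncard_le_ncard ?_ (Set.toFinite _)) this
        rintro _ ⟨v, hv, rfl⟩
        simp only [Set.mem_ofPred_eq, sign_eq_zero_iff] at hv
        refine ⟨⟨v - p, ?_⟩, ?_⟩
        · rw [LinearMap.mem_ker, map_sub, hpl]; linarith
        · funext i
          simp only [LinearMap.coe_comp, Submodule.coe_subtype, Function.comp_apply, map_sub]
          congr 1; ring
      have hd : 1 ≤ Module.finrank ℝ V := by
        by_contra h
        have h0 : Module.finrank ℝ V = 0 := by omega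
        have := Module.finrank_zero_iff.mp h0
        apply hl
        ext v
        rw [Subsingleton.elim v 0]; simp
      obtain ⟨d, hdd⟩ : ∃ d, Module.finrank ℝ V = d + 1 := ⟨Module.finrank ℝ V - 1, by omega⟩
      rw [hdd] at hR'c hT0 ⊢
      have hT0' : (T 0).ncard ≤ (2 * q + 1) ^ d := hT0
      calc R.ncard ≤ _ := Set.ncard_le_ncard hRT (Set.toFinite _)
        _ ≤ (T 0).ncard + ((T 1).ncard + (T (-1)).ncard) := by
          refine (Set.ncard_union_le _ _).trans (Nat.add_le_add (himg 0) ?_)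
          exact (Set.ncard_union_le _ _).trans (Nat.add_le_add (himg 1) (himg (-1)))
        _ ≤ (2 * q + 1) ^ (d + 1) + 2 * (2 * q + 1) ^ d := by omega
        _ = (2 * (q + 1) + 1) * (2 * q + 1) ^ d := by ring
        _ ≤ (2 * (q + 1) + 1) * (2 * (q + 1) + 1) ^ d :=
          Nat.mul_le_mul_left _ (Nat.pow_le_pow_left (by omega) _)
        _ = _ := by ring

theorem aux_signs {ι : Type*} [Fintype ι] {V : Type} [AddCommGroup V] [Module ℝ V] [FiniteDimensional ℝ V]
    (ℓ : ι → V →ₗ[ℝ] ℝ) (c : ι → ℝ) :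
    (Set.range (fun (v : V) (i : ι) => SignType.sign (ℓ i v + c i))).ncard ≤
      (2 * Fintype.card ι + 1) ^ (Module.finrank ℝ V) := by
  classical
  set e := (Fintype.equivFin ι).symm
  refine le_trans ?_ (aux_signs_fin (Fintype.card ι) V (fun i => ℓ (e i)) (fun i => c (e i)))
  apply Set.ncard_le_ncard_of_injOn (fun s i => s (e i))
  · rintro _ ⟨v, rfl⟩; exact ⟨v, rfl⟩
  · intro s _ s' _ h
    funext i
    have := congrFun h (e.symm i)
    simpa using this

/-- sign vector of a point with respect to an arrangement of affine functionals -/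
def aSg {ι : Type*} (ℓ : ι → (Fin 4 → ℝ) →ₗ[ℝ] ℝ) (c : ι → ℝ) (v : Fin 4 → ℝ) : ι → SignType :=
  fun i => SignType.sign (ℓ i v + c i)

/-- closed face relation -/
def aFace {ι : Type*} (ℓ : ι → (Fin 4 → ℝ) →ₗ[ℝ] ℝ) (c : ι → ℝ) (σ : ι → SignType)
    (z : Fin 4 → ℝ) : Prop :=
  ∀ i, ℓ i z + c i = 0 ∨ SignType.sign (ℓ i z + c i) = σ i

/-- vertices of the arrangement -/
def aVert {ι : Type*} (ℓ : ι → (Fin 4 → ℝ) →ₗ[ℝ] ℝ) (c : ι → ℝ) (a : Fin 4 → ℝ) : Prop :=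
  ∀ u, (∀ i, ℓ i a + c i = 0 → ℓ i u = 0) → u = 0

/-- points in the bounded region -/
def aIn {ι : Type*} (ℓ : ι → (Fin 4 → ℝ) →ₗ[ℝ] ℝ) (c : ι → ℝ) (y : Fin 4 → ℝ) : Prop :=
  ∀ u, u ≠ 0 → ∃ i, ℓ i u < 0 ∧ 0 ≤ ℓ i y + c i

open Classical in
/-- chosen vertex of a face -/
def aApex {ι : Type*} (ℓ : ι → (Fin 4 → ℝ) →ₗ[ℝ] ℝ) (c : ι → ℝ) (σ : ι → SignType) : Fin 4 → ℝ :=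
  if h : ∃ a, aVert ℓ c a ∧ aFace ℓ c σ a then h.choose else 0

/-- one step of the chain -/
def aNextRel {ι : Type*} (ℓ : ι → (Fin 4 → ℝ) →ₗ[ℝ] ℝ) (c : ι → ℝ) (y z : Fin 4 → ℝ) : Prop :=
  aFace ℓ c (aSg ℓ c y) z ∧
  (∃ t : ℝ, 0 < t ∧ (1 + t) • y = z + t • aApex ℓ c (aSg ℓ c y)) ∧
  (y = aApex ℓ c (aSg ℓ c y) → z = y) ∧
  (y ≠ aApex ℓ c (aSg ℓ c y) → ∃ i, ℓ i y + c i ≠ 0 ∧ ℓ i z + c i = 0)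

open Classical in
/-- next point of the chain -/
def aNext {ι : Type*} (ℓ : ι → (Fin 4 → ℝ) →ₗ[ℝ] ℝ) (c : ι → ℝ) (y : Fin 4 → ℝ) : Fin 4 → ℝ :=
  if h : ∃ z, aNextRel ℓ c y z then h.choose else y

/-- the chain -/
def aIter {ι : Type*} (ℓ : ι → (Fin 4 → ℝ) →ₗ[ℝ] ℝ) (c : ι → ℝ) (y : Fin 4 → ℝ) (j : ℕ) :
    Fin 4 → ℝ := (aNext ℓ c)^[j] y

/-- the simplex vertices -/
def aTau {ι : Type*} (ℓ : ι → (Fin 4 → ℝ) →ₗ[ℝ] ℝ) (c : ι → ℝ) (y : Fin 4 → ℝ) (j : ℕ) :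
    Fin 4 → ℝ := aApex ℓ c (aSg ℓ c (aIter ℓ c y j))

theorem aFace_zero {ι : Type*} {ℓ : ι → (Fin 4 → ℝ) →ₗ[ℝ] ℝ} {c : ι → ℝ} {y z : Fin 4 → ℝ}
    (h : aFace ℓ c (aSg ℓ c y) z) (i : ι) (hi : ℓ i y + c i = 0) : ℓ i z + c i = 0 := by
  rcases h i with h | h
  · exact h
  · simp only [aSg, hi, sign_zero] at h
    exact sign_eq_zero_iff.mp h

theorem aFace_trans {ι : Type*} {ℓ : ι → (Fin 4 → ℝ) →ₗ[ℝ] ℝ} {c : ι → ℝ} {x y z : Fin 4 → ℝ}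
    (h : aFace ℓ c (aSg ℓ c x) y) (h' : aFace ℓ c (aSg ℓ c y) z) : aFace ℓ c (aSg ℓ c x) z := by
  intro i
  rcases h' i with h1 | h1
  · exact Or.inl h1
  · rcases h i with h2 | h2
    · exact Or.inl (aFace_zero h' i h2)
    · right; rw [h1]; exact h2

theorem aFace_refl {ι : Type*} {ℓ : ι → (Fin 4 → ℝ) →ₗ[ℝ] ℝ} {c : ι → ℝ} {x : Fin 4 → ℝ} :
    aFace ℓ c (aSg ℓ c x) x := fun _ => Or.inr rfl

theorem aIn_face {ι : Type*} {ℓ : ι → (Fin 4 → ℝ) →ₗ[ℝ] ℝ} {c : ι → ℝ} {y z : Fin 4 → ℝ}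
    (h : aFace ℓ c (aSg ℓ c y) z) (hy : aIn ℓ c y) : aIn ℓ c z := by
  intro u hu
  obtain ⟨i, h1, h2⟩ := hy u hu
  refine ⟨i, h1, ?_⟩
  rcases h i with h3 | h3
  · exact h3.ge
  · by_contra hneg
    push Not at hneg
    rw [sign_neg hneg] at h3
    have : ℓ i y + c i < 0 := sign_eq_neg_one_iff.mp h3.symm
    linarith

theorem aExit {ι : Type*} [Fintype ι] {ℓ : ι → (Fin 4 → ℝ) →ₗ[ℝ] ℝ} {c : ι → ℝ} {y u : Fin 4 → ℝ}
    (hy : aIn ℓ c y) (hu : u ≠ 0) (hz : ∀ i, ℓ i y + c i = 0 → ℓ i u = 0) :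
    ∃ t : ℝ, 0 < t ∧ aFace ℓ c (aSg ℓ c y) (y + t • u) ∧
      ∃ i, ℓ i y + c i ≠ 0 ∧ ℓ i (y + t • u) + c i = 0 := by
  classical
  set I := Finset.univ.filter (fun i : ι => (ℓ i y + c i) * ℓ i u < 0) with hI
  have hne : I.Nonempty := by
    obtain ⟨i, h1, h2⟩ := hy u hu
    refine ⟨i, ?_⟩
    rw [hI, Finset.mem_filter]
    refine ⟨Finset.mem_univ _, ?_⟩
    have : ℓ i y + c i ≠ 0 := fun h => h1.ne (hz i h)
    have : 0 < ℓ i y + c i := lt_of_le_of_ne h2 this.symm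
    exact mul_neg_of_pos_of_neg this h1
  obtain ⟨i0, hi0, hmin⟩ := Finset.exists_min_image I (fun i => -(ℓ i y + c i) / ℓ i u) hne
  have hval : ∀ i t, ℓ i (y + t • u) + c i = (ℓ i y + c i) + t * ℓ i u := by
    intro i t; simp only [map_add, map_smul, smul_eq_mul]; ring
  have hpos : ∀ i ∈ I, 0 < -(ℓ i y + c i) / ℓ i u := by
    intro i hi
    have h := (Finset.mem_filter.mp hi).2
    rcases lt_trichotomy (ℓ i u) 0 with h1 | h1 | h1
    · exact div_pos_of_neg_of_neg (by nlinarith) h1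
    · rw [h1] at h; simp at h
    · exact div_pos (by nlinarith) h1
  have hI0 := (Finset.mem_filter.mp hi0).2
  have hu0 : ℓ i0 u ≠ 0 := by intro h; rw [h] at hI0; simp at hI0
  have hy0 : ℓ i0 y + c i0 ≠ 0 := by intro h; rw [h] at hI0; simp at hI0
  set t := -(ℓ i0 y + c i0) / ℓ i0 u with ht
  have ht0 := hpos i0 hi0
  refine ⟨t, ht0, ?_, i0, hy0, ?_⟩
  · intro i
    rw [hval]
    by_cases hi : i ∈ I
    · have hm := hmin i hi
      have h := (Finset.mem_filter.mp hi).2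
      rcases lt_trichotomy (ℓ i u) 0 with h1 | h1 | h1
      · rw [le_div_iff_of_neg h1] at hm
        have hp : 0 < ℓ i y + c i := by nlinarith
        rcases eq_or_lt_of_le (show 0 ≤ (ℓ i y + c i) + t * ℓ i u by linarith) with h2 | h2
        · exact Or.inl h2.symm
        · right; rw [sign_pos h2, aSg, sign_pos hp]
      · rw [h1] at h; simp at h
      · rw [le_div_iff₀ h1] at hm
        have hp : ℓ i y + c i < 0 := by nlinarith
        rcases eq_or_lt_of_le (show (ℓ i y + c i) + t * ℓ i u ≤ 0 by linarith) with h2 | h2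
        · exact Or.inl h2
        · right; rw [sign_neg h2, aSg, sign_neg hp]
    · have h : 0 ≤ (ℓ i y + c i) * ℓ i u := by
        by_contra hc
        push Not at hc
        exact hi (by rw [hI, Finset.mem_filter]; exact ⟨Finset.mem_univ _, hc⟩)
      rcases lt_trichotomy (ℓ i y + c i) 0 with h1 | h1 | h1
      · right
        have : ℓ i u ≤ 0 := by nlinarith
        rw [sign_neg (by nlinarith), aSg, sign_neg h1]
      · left; rw [hz i h1, h1]; simp
      · right
        have : 0 ≤ ℓ i u := by nlinarith
        rw [sign_pos (by nlinarith), aSg, sign_pos h1]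
  · rw [hval, ht]; field_simp; ring

theorem aVert_exists {ι : Type*} [Fintype ι] {ℓ : ι → (Fin 4 → ℝ) →ₗ[ℝ] ℝ} {c : ι → ℝ} :
    ∀ (N : ℕ) (y : Fin 4 → ℝ), (Set.ncard {i | ℓ i y + c i ≠ 0}) ≤ N → aIn ℓ c y →
      ∃ a, aVert ℓ c a ∧ aFace ℓ c (aSg ℓ c y) a := by
  intro N
  induction N with
  | zero =>
    intro y hN hy
    refine ⟨y, ?_, aFace_refl⟩
    have h0 : {i | ℓ i y + c i ≠ 0} = ∅ := by
      rw [← Set.ncard_eq_zero (Set.toFinite _)]; omega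
    intro u hu
    by_contra hne
    obtain ⟨i, h1, h2⟩ := hy u hne
    have hi : ℓ i y + c i = 0 := by
      by_contra h
      have : i ∈ {i | ℓ i y + c i ≠ 0} := h
      rw [h0] at this; exact this
    exact h1.ne (hu i hi)
  | succ N ih =>
    intro y hN hy
    by_cases hv : aVert ℓ c y
    · exact ⟨y, hv, aFace_refl⟩
    · unfold aVert at hv
      push Not at hv
      obtain ⟨u, hu, hu0⟩ := hv
      obtain ⟨t, ht, hf, i, hi1, hi2⟩ := aExit hy hu0 hu
      have hlt : Set.ncard {i | ℓ i (y + t • u) + c i ≠ 0} < Set.ncard {i | ℓ i y + c i ≠ 0} := by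
        apply Set.ncard_lt_ncard _ (Set.toFinite _)
        refine ⟨fun k hk h => hk (aFace_zero hf k h), fun h => ?_⟩
        exact h (show i ∈ {i | ℓ i y + c i ≠ 0} from hi1) hi2
      obtain ⟨a, ha, hfa⟩ := ih (y + t • u) (by omega) (aIn_face hf hy)
      exact ⟨a, ha, aFace_trans hf hfa⟩

theorem aApex_spec {ι : Type*} [Fintype ι] {ℓ : ι → (Fin 4 → ℝ) →ₗ[ℝ] ℝ} {c : ι → ℝ}
    {y : Fin 4 → ℝ} (hy : aIn ℓ c y) :
    aVert ℓ c (aApex ℓ c (aSg ℓ c y)) ∧ aFace ℓ c (aSg ℓ c y) (aApex ℓ c (aSg ℓ c y)) := by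
  have h := aVert_exists _ y le_rfl hy
  unfold aApex
  rw [dif_pos h]
  exact h.choose_spec

theorem aNext_spec {ι : Type*} [Fintype ι] {ℓ : ι → (Fin 4 → ℝ) →ₗ[ℝ] ℝ} {c : ι → ℝ}
    {y : Fin 4 → ℝ} (hy : aIn ℓ c y) : aNextRel ℓ c y (aNext ℓ c y) := by
  have h : ∃ z, aNextRel ℓ c y z := by
    obtain ⟨hv, hf⟩ := aApex_spec hy
    by_cases hya : y = aApex ℓ c (aSg ℓ c y)
    · refine ⟨y, aFace_refl, ⟨1, one_pos, ?_⟩, fun _ => rfl, fun h => absurd hya h⟩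
      rw [← hya, add_smul, one_smul]
    · obtain ⟨t, ht, hf', i, hi1, hi2⟩ := aExit (u := y - aApex ℓ c (aSg ℓ c y)) hy (sub_ne_zero.mpr hya)
        (by
          intro i hi
          have := aFace_zero hf i hi
          rw [map_sub]; linarith)
      refine ⟨_, hf', ⟨t, ht, ?_⟩, fun h => absurd h hya, fun _ => ⟨i, hi1, hi2⟩⟩
      rw [add_smul, one_smul, smul_sub]; abel
  unfold aNext
  rw [dif_pos h]
  exact h.choose_spec

theorem aIter_succ {ι : Type*} {ℓ : ι → (Fin 4 → ℝ) →ₗ[ℝ] ℝ} {c : ι → ℝ} (y : Fin 4 → ℝ) (j : ℕ) :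
    aIter ℓ c y (j + 1) = aNext ℓ c (aIter ℓ c y j) := Function.iterate_succ_apply' _ _ _

theorem aIter_in {ι : Type*} [Fintype ι] {ℓ : ι → (Fin 4 → ℝ) →ₗ[ℝ] ℝ} {c : ι → ℝ}
    {y : Fin 4 → ℝ} (hy : aIn ℓ c y) (j : ℕ) : aIn ℓ c (aIter ℓ c y j) := by
  induction j with
  | zero => exact hy
  | succ j ih => rw [aIter_succ]; exact aIn_face (aNext_spec ih).1 ih

theorem aIter_face {ι : Type*} [Fintype ι] {ℓ : ι → (Fin 4 → ℝ) →ₗ[ℝ] ℝ} {c : ι → ℝ}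
    {y : Fin 4 → ℝ} (hy : aIn ℓ c y) (j k : ℕ) :
    aFace ℓ c (aSg ℓ c (aIter ℓ c y j)) (aIter ℓ c y (j + k)) := by
  induction k with
  | zero => exact aFace_refl
  | succ k ih =>
    rw [← add_assoc, aIter_succ]
    exact aFace_trans ih (aNext_spec (aIter_in hy _)).1

theorem aTau_face {ι : Type*} [Fintype ι] {ℓ : ι → (Fin 4 → ℝ) →ₗ[ℝ] ℝ} {c : ι → ℝ}
    {y : Fin 4 → ℝ} (hy : aIn ℓ c y) (j : ℕ) : aFace ℓ c (aSg ℓ c y) (aTau ℓ c y j) := by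
  have h1 := aIter_face hy 0 j
  rw [zero_add] at h1
  exact aFace_trans h1 (aApex_spec (aIter_in hy j)).2

theorem aTau_vert {ι : Type*} [Fintype ι] {ℓ : ι → (Fin 4 → ℝ) →ₗ[ℝ] ℝ} {c : ι → ℝ}
    {y : Fin 4 → ℝ} (hy : aIn ℓ c y) (j : ℕ) : aVert ℓ c (aTau ℓ c y j) :=
  (aApex_spec (aIter_in hy j)).1

/-- direction space of a face -/
def aDir {ι : Type*} (ℓ : ι → (Fin 4 → ℝ) →ₗ[ℝ] ℝ) (c : ι → ℝ) (y : Fin 4 → ℝ) :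
    Submodule ℝ (Fin 4 → ℝ) where
  carrier := {u | ∀ i, ℓ i y + c i = 0 → ℓ i u = 0}
  add_mem' := by
    intro a b ha hb i hi
    rw [map_add, ha i hi, hb i hi, add_zero]
  zero_mem' := by intro i _; simp
  smul_mem' := by
    intro r a ha i hi
    rw [map_smul, ha i hi, smul_zero]

theorem aTau_last {ι : Type*} [Fintype ι] {ℓ : ι → (Fin 4 → ℝ) →ₗ[ℝ] ℝ} {c : ι → ℝ}
    {y : Fin 4 → ℝ} (hy : aIn ℓ c y) : aIter ℓ c y 4 = aTau ℓ c y 4 := by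
  have key : ∀ j : ℕ, aIter ℓ c y j = aTau ℓ c y j ∨
      Module.finrank ℝ (aDir ℓ c (aIter ℓ c y j)) + j ≤ 4 := by
    intro j
    induction j with
    | zero =>
      right
      have := Submodule.finrank_le (aDir ℓ c (aIter ℓ c y 0))
      simpa using this
    | succ j ih =>
      have hin := aIter_in hy j
      have hsp := aNext_spec hin
      rw [← aIter_succ] at hsp
      obtain ⟨h1, ⟨t, ht, h2⟩, h3, h4⟩ := hsp
      by_cases he : aIter ℓ c y j = aTau ℓ c y j
      · left
        have := h3 he
        unfold aTau at he ⊢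
        rw [this]; exact he
      · right
        have hle : Module.finrank ℝ (aDir ℓ c (aIter ℓ c y j)) + j ≤ 4 := by
          rcases ih with h | h
          · exact absurd h he
          · exact h
        obtain ⟨i, hi1, hi2⟩ := h4 he
        have hlt : aDir ℓ c (aIter ℓ c y (j + 1)) < aDir ℓ c (aIter ℓ c y j) := by
          refine lt_of_le_of_ne (fun u hu k hk => hu k (aFace_zero h1 k hk)) fun heq => ?_
          have hmem : aIter ℓ c y j - aTau ℓ c y j ∈ aDir ℓ c (aIter ℓ c y j) := by
            intro k hk
            have := aFace_zero (aApex_spec hin).2 k hk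
            rw [map_sub]; unfold aTau; linarith
          rw [← heq] at hmem
          have h5 := hmem i hi2
          have h6 := congrArg (ℓ i) h2
          simp only [map_add, map_smul, smul_eq_mul] at h6
          rw [map_sub] at h5
          unfold aTau at h5
          apply hi1
          have h7 : ℓ i (aApex ℓ c (aSg ℓ c (aIter ℓ c y j))) = ℓ i (aIter ℓ c y j) := by linarith
          rw [h7] at h6
          linarith
        have := Submodule.finrank_lt_finrank_of_lt hlt
        omega
  rcases key 4 with h | h
  · exact h
  · have h0 : Module.finrank ℝ (aDir ℓ c (aIter ℓ c y 4)) = 0 := by omega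
    rw [Submodule.finrank_eq_zero] at h0
    have hmem : aIter ℓ c y 4 - aTau ℓ c y 4 ∈ aDir ℓ c (aIter ℓ c y 4) := by
      intro k hk
      have := aFace_zero (aApex_spec (aIter_in hy 4)).2 k hk
      rw [map_sub]; unfold aTau; linarith
    rw [h0, Submodule.mem_bot] at hmem
    exact sub_eq_zero.mp hmem

theorem aTau_nonneg {ι : Type*} [Fintype ι] {ℓ : ι → (Fin 4 → ℝ) →ₗ[ℝ] ℝ} {c : ι → ℝ}
    {y : Fin 4 → ℝ} (hy : aIn ℓ c y) (g : (Fin 4 → ℝ) →ₗ[ℝ] ℝ) (d : ℝ) (hg : g y + d = 0)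
    (hn : ∀ j < 5, 0 ≤ g (aTau ℓ c y j) + d) : ∀ j < 5, g (aTau ℓ c y j) + d = 0 := by
  have step : ∀ j, ∃ t : ℝ, 0 < t ∧ (1 + t) * (g (aIter ℓ c y j) + d) =
      (g (aIter ℓ c y (j + 1)) + d) + t * (g (aTau ℓ c y j) + d) := by
    intro j
    obtain ⟨-, ⟨t, ht, h2⟩, -, -⟩ := aNext_spec (aIter_in hy j)
    rw [← aIter_succ] at h2
    refine ⟨t, ht, ?_⟩
    have h6 := congrArg g h2
    simp only [map_add, map_smul, smul_eq_mul] at h6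
    unfold aTau
    linear_combination h6
  have h0 : g (aIter ℓ c y 0) + d = 0 := hg
  have n4 : 0 ≤ g (aIter ℓ c y 4) + d := by rw [aTau_last hy]; exact hn 4 (by norm_num)
  have back : ∀ j < 5, 0 ≤ g (aIter ℓ c y (j + 1)) + d → 0 ≤ g (aIter ℓ c y j) + d := by
    intro j hj h
    obtain ⟨t, ht, he⟩ := step j
    have h1 := mul_nonneg ht.le (hn j hj)
    by_contra hc
    push Not at hc
    nlinarith
  have n3 := back 3 (by norm_num) n4
  have n2 := back 2 (by norm_num) n3
  have n1 := back 1 (by norm_num) n2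
  have fwd : ∀ j < 5, g (aIter ℓ c y j) + d = 0 → 0 ≤ g (aIter ℓ c y (j + 1)) + d →
      g (aIter ℓ c y (j + 1)) + d = 0 ∧ g (aTau ℓ c y j) + d = 0 := by
    intro j hj h h'
    obtain ⟨t, ht, he⟩ := step j
    have h1 := mul_nonneg ht.le (hn j hj)
    rw [h, mul_zero] at he
    have h2 : g (aIter ℓ c y (j + 1)) + d = 0 := by linarith
    have h3 : t * (g (aTau ℓ c y j) + d) = 0 := by linarith
    rcases mul_eq_zero.mp h3 with h4 | h4
    · exact absurd h4 ht.ne'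
    · exact ⟨h2, h4⟩
  obtain ⟨a1, b0⟩ := fwd 0 (by norm_num) h0 n1
  obtain ⟨a2, b1⟩ := fwd 1 (by norm_num) a1 n2
  obtain ⟨a3, b2⟩ := fwd 2 (by norm_num) a2 n3
  obtain ⟨a4, b3⟩ := fwd 3 (by norm_num) a3 n4
  intro j hj
  interval_cases j
  · exact b0
  · exact b1
  · exact b2
  · exact b3
  · rw [aTau_last hy] at a4; exact a4

/-- A hyperplane through `y` either contains all simplex vertices or strictly separates two. -/
theorem aTau_conflict {ι : Type*} [Fintype ι] {ℓ : ι → (Fin 4 → ℝ) →ₗ[ℝ] ℝ} {c : ι → ℝ}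
    {y : Fin 4 → ℝ} (hy : aIn ℓ c y) (g : (Fin 4 → ℝ) →ₗ[ℝ] ℝ) (d : ℝ) (hg : g y + d = 0) :
    (∀ j < 5, g (aTau ℓ c y j) + d = 0) ∨
    (∃ j < 5, ∃ k < 5, 0 < g (aTau ℓ c y j) + d ∧ g (aTau ℓ c y k) + d < 0) := by
  by_cases h1 : ∀ j < 5, 0 ≤ g (aTau ℓ c y j) + d
  · exact Or.inl (aTau_nonneg hy g d hg h1)
  by_cases h2 : ∀ j < 5, 0 ≤ (-g) (aTau ℓ c y j) + (-d)
  · left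
    intro j hj
    have := aTau_nonneg hy (-g) (-d) (by rw [LinearMap.neg_apply]; linarith) h2 j hj
    rw [LinearMap.neg_apply] at this; linarith
  right
  push Not at h1 h2
  obtain ⟨k, hk, h1⟩ := h1
  obtain ⟨j, hj, h2⟩ := h2
  rw [LinearMap.neg_apply] at h2
  exact ⟨j, hj, k, hk, by linarith, h1⟩

theorem aTau_noconflict {ι : Type*} [Fintype ι] {ℓ : ι → (Fin 4 → ℝ) →ₗ[ℝ] ℝ} {c : ι → ℝ}
    {y : Fin 4 → ℝ} (hy : aIn ℓ c y) (i : ι) (j k : ℕ) (h1 : 0 < ℓ i (aTau ℓ c y j) + c i)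
    (h2 : ℓ i (aTau ℓ c y k) + c i < 0) : False := by
  rcases aTau_face hy j i with a | a
  · linarith
  rcases aTau_face hy k i with b | b
  · linarith
  rw [sign_pos h1] at a
  rw [sign_neg h2, ← a] at b
  exact absurd b (by decide)

theorem aux_card_image_det {α β γ : Type*} [DecidableEq β] [DecidableEq γ] (S : Finset α) (f : α → β)
    (g : α → γ) (h : ∀ x ∈ S, ∀ y ∈ S, g x = g y → f x = f y) : (S.image f).card ≤ (S.image g).card := by
  classical
  rcases S.eq_empty_or_nonempty with rfl | ⟨x0, hx0⟩
  · simp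
  set φ : γ → β := fun c => if hc : ∃ x ∈ S, g x = c then f hc.choose else f x0 with hφ
  have : S.image f ⊆ (S.image g).image φ := by
    intro b hb
    obtain ⟨x, hx, rfl⟩ := Finset.mem_image.mp hb
    refine Finset.mem_image.mpr ⟨g x, Finset.mem_image_of_mem _ hx, ?_⟩
    have hc : ∃ z ∈ S, g z = g x := ⟨x, hx, rfl⟩
    simp only [hφ]
    rw [dif_pos hc]
    exact h _ hc.choose_spec.1 _ hx hc.choose_spec.2
  exact (Finset.card_le_card this).trans Finset.card_image_le

theorem aux_gap (Z : Finset ℝ) : ∃ a b : ℝ, 0 < a ∧ 0 < b ∧ ∀ x ∈ Z, x = 0 ∨ (a ≤ |x| ∧ |x| ≤ b) := by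
  classical
  induction Z using Finset.induction_on with
  | empty => exact ⟨1, 1, one_pos, one_pos, by simp⟩
  | insert z Z _ ih =>
    obtain ⟨a, b, ha, hb, h⟩ := ih
    by_cases hz : z = 0
    · refine ⟨a, b, ha, hb, ?_⟩
      intro x hx
      rcases Finset.mem_insert.mp hx with rfl | hx
      · exact Or.inl hz
      · exact h x hx
    · refine ⟨min a |z|, max b |z|, lt_min ha (abs_pos.mpr hz), lt_max_of_lt_left hb, ?_⟩
      intro x hx
      rcases Finset.mem_insert.mp hx with rfl | hx
      · exact Or.inr ⟨min_le_right _ _, le_max_right _ _⟩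
      · rcases h x hx with h | h
        · exact Or.inl h
        · exact Or.inr ⟨(min_le_left _ _).trans h.1, h.2.trans (le_max_left _ _)⟩

theorem aux_decode {a b e : ℝ} (ha : 0 < a) (hb : 0 < b) (he : 0 < e) (he1 : e ≤ 1)
    (heb : 5 * b * e ≤ a / 2) (F : ℕ → ℝ) (hF : ∀ j < 5, F j = 0 ∨ (a ≤ |F j| ∧ |F j| ≤ b))
    (hm : ∀ j k, j ≤ k → k < 5 → F k = 0 ∨ 0 < F j * F k) (j : ℕ) (hj : j < 5) :
    0 < F j ↔ 0 < ∑ k ∈ Finset.range 5, e ^ (4 - k) * F k - a / 2 * e ^ (4 - j) := by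
  have hej : 0 < e ^ (4 - j) := by positivity
  constructor
  · intro h
    have hnn : ∀ k ∈ Finset.range 5, 0 ≤ e ^ (4 - k) * F k := by
      intro k hk
      have hk5 := Finset.mem_range.mp hk
      apply mul_nonneg (by positivity)
      rcases le_total j k with hjk | hjk
      · rcases hm j k hjk hk5 with h1 | h1
        · exact h1.ge
        · nlinarith
      · rcases hm k j hjk hj with h1 | h1
        · linarith
        · nlinarith
    have h1 := Finset.single_le_sum hnn (Finset.mem_range.mpr hj)
    rcases hF j hj with h2 | ⟨h2, -⟩
    · linarith
    · rw [abs_of_pos h] at h2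
      have h3 : e ^ (4 - j) * a ≤ e ^ (4 - j) * F j := mul_le_mul_of_nonneg_left h2 hej.le
      nlinarith
  · intro h
    by_contra hc
    push Not at hc
    rcases eq_or_lt_of_le hc with h0 | h0
    · have hb2 : ∀ k ∈ Finset.range 5, e ^ (4 - k) * F k ≤ e ^ (4 - j) * (b * e) := by
        intro k hk
        have hk5 := Finset.mem_range.mp hk
        rcases le_or_gt j k with hjk | hjk
        · have : F k = 0 := by
            rcases hm j k hjk hk5 with h1 | h1
            · exact h1
            · rw [h0] at h1; simp at h1
          rw [this, mul_zero]; positivity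
        · have h1 : F k ≤ b := by
            rcases hF k hk5 with h2 | ⟨-, h2⟩
            · rw [h2]; exact hb.le
            · exact (le_abs_self _).trans h2
          have h2 : e ^ (4 - k) ≤ e ^ (4 - j + 1) := pow_le_pow_of_le_one he.le he1 (by omega)
          calc e ^ (4 - k) * F k ≤ e ^ (4 - k) * b := mul_le_mul_of_nonneg_left h1 (by positivity)
            _ ≤ e ^ (4 - j + 1) * b := mul_le_mul_of_nonneg_right h2 hb.le
            _ = _ := by rw [pow_succ]; ring
      have h3 := Finset.sum_le_sum hb2
      simp only [Finset.sum_const, Finset.card_range, nsmul_eq_mul] at h3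
      push_cast at h3
      nlinarith
    · have hnn : ∑ k ∈ Finset.range 5, e ^ (4 - k) * F k ≤ 0 := by
        apply Finset.sum_nonpos
        intro k hk
        have hk5 := Finset.mem_range.mp hk
        apply mul_nonpos_of_nonneg_of_nonpos (by positivity)
        rcases le_total j k with hjk | hjk
        · rcases hm j k hjk hk5 with h1 | h1
          · exact h1.le
          · nlinarith
        · rcases hm k j hjk hj with h1 | h1
          · linarith
          · nlinarith
      have : 0 < a / 2 * e ^ (4 - j) := by positivity
      linarith

theorem aFace_mul {ι : Type*} {ℓ : ι → (Fin 4 → ℝ) →ₗ[ℝ] ℝ} {c : ι → ℝ} {y z : Fin 4 → ℝ}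
    (h : aFace ℓ c (aSg ℓ c y) z) (i : ι) : ℓ i z + c i = 0 ∨ 0 < (ℓ i y + c i) * (ℓ i z + c i) := by
  rcases h i with h1 | h1
  · exact Or.inl h1
  · simp only [aSg] at h1
    rcases lt_trichotomy (ℓ i z + c i) 0 with h2 | h2 | h2
    · right
      rw [sign_neg h2] at h1
      exact mul_pos_of_neg_of_neg (sign_eq_neg_one_iff.mp h1.symm) h2
    · exact Or.inl h2
    · right
      rw [sign_pos h2] at h1
      exact mul_pos (sign_eq_one_iff.mp h1.symm) h2

theorem aTau_count {ι : Type*} [Fintype ι] (ℓ : ι → (Fin 4 → ℝ) →ₗ[ℝ] ℝ) (c : ι → ℝ)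
    (Y : Finset (Fin 4 → ℝ)) (hY : ∀ y ∈ Y, aIn ℓ c y) :
    (Y.image (fun y => fun j : Fin 5 => aTau ℓ c y j)).card ≤ (20 * Fintype.card ι + 1) ^ 4 := by
  classical
  obtain ⟨a, b, ha, hb, hgap⟩ := aux_gap ((Y ×ˢ (Finset.univ : Finset ι) ×ˢ Finset.range 5).image
    (fun p => ℓ p.2.1 (aIter ℓ c p.1 p.2.2) + c p.2.1))
  set e : ℝ := a / (a + 20 * b) with he
  have he0 : 0 < e := by positivity
  have he1 : e ≤ 1 := by rw [he, div_le_one (by positivity)]; linarith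
  have heb : 5 * b * e ≤ a / 2 := by
    rw [he, mul_div_assoc', div_le_iff₀ (by positivity)]
    nlinarith [mul_pos ha hb]
  set S : ℝ := ∑ k ∈ Finset.range 5, e ^ (4 - k) with hS
  set W : (Fin 4 → ℝ) → (Fin 4 → ℝ) := fun y => ∑ k ∈ Finset.range 5, e ^ (4 - k) • aIter ℓ c y k with hW
  have hWv : ∀ i y, ℓ i (W y) + S * c i = ∑ k ∈ Finset.range 5, e ^ (4 - k) * (ℓ i (aIter ℓ c y k) + c i) := by
    intro i y
    simp only [hW, hS, map_sum, map_smul, smul_eq_mul, mul_add, Finset.sum_add_distrib, Finset.sum_mul]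
  set L : ι × Fin 5 × Bool → (Fin 4 → ℝ) →ₗ[ℝ] ℝ := fun p => ℓ p.1 with hL
  set cc : ι × Fin 5 × Bool → ℝ := fun p => S * c p.1 +
    (if p.2.2 then -(a / 2 * e ^ (4 - (p.2.1 : ℕ))) else a / 2 * e ^ (4 - (p.2.1 : ℕ))) with hcc
  have hcount := aux_signs L cc
  set sg : (Fin 4 → ℝ) → (ι × Fin 5 × Bool → SignType) := fun y p => SignType.sign (L p (W y) + cc p) with hsg
  have hpos : ∀ y ∈ Y, ∀ i, ∀ j : Fin 5, 0 < ℓ i (aIter ℓ c y j) + c i ↔ sg y (i, j, true) = 1 := by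
    intro y hy i j
    have := aux_decode ha hb he0 he1 heb (fun k => ℓ i (aIter ℓ c y k) + c i)
      (fun k hk => hgap _ (Finset.mem_image.mpr ⟨(y, i, k), by simp [hy, hk], rfl⟩))
      (fun k k' hk hk' => by
        obtain ⟨d, rfl⟩ := Nat.exists_eq_add_of_le hk
        exact aFace_mul (aIter_face (hY y hy) k d) i) j j.2
    rw [this, hsg]
    simp only [hL, hcc, if_true, sign_eq_one_iff]
    rw [← add_assoc, hWv]
    rfl
  have hneg : ∀ y ∈ Y, ∀ i, ∀ j : Fin 5, ℓ i (aIter ℓ c y j) + c i < 0 ↔ sg y (i, j, false) = -1 := by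
    intro y hy i j
    have := aux_decode ha hb he0 he1 heb (fun k => -(ℓ i (aIter ℓ c y k) + c i))
      (fun k hk => by
        have := hgap _ (Finset.mem_image.mpr ⟨(y, i, k), by simp [hy, hk], rfl⟩)
        rw [neg_eq_zero, abs_neg]; exact this)
      (fun k k' hk hk' => by
        obtain ⟨d, rfl⟩ := Nat.exists_eq_add_of_le hk
        rw [neg_eq_zero, neg_mul_neg]
        exact aFace_mul (aIter_face (hY y hy) k d) i) j j.2
    rw [← neg_pos, this, hsg]
    simp only [hL, hcc, Bool.false_eq_true, if_false, sign_eq_neg_one_iff]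
    rw [← add_assoc, hWv]
    simp only [mul_neg, Finset.sum_neg_distrib]
    constructor <;> intro h <;> linarith
  have h1 : (Y.image (fun y => fun j : Fin 5 => aTau ℓ c y j)).card ≤ (Y.image sg).card := by
    apply aux_card_image_det
    intro y hy y' hy' hyy
    funext j
    unfold aTau
    congr 1
    funext i
    have p1 := hpos y hy i j
    have p2 := hpos y' hy' i j
    have n1 := hneg y hy i j
    have n2 := hneg y' hy' i j
    rw [hyy, ← p2] at p1
    rw [hyy, ← n2] at n1
    simp only [aSg]
    rcases lt_trichotomy (ℓ i (aIter ℓ c y j) + c i) 0 with h | h | h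
    · rw [sign_neg h, sign_neg (n1.mp h)]
    · have : ℓ i (aIter ℓ c y' j) + c i = 0 := by
        rcases lt_trichotomy (ℓ i (aIter ℓ c y' j) + c i) 0 with h' | h' | h'
        · have := n1.mpr h'; linarith
        · exact h'
        · have := p1.mpr h'; linarith
      rw [h, this]
    · rw [sign_pos h, sign_pos (p1.mp h)]
  have h2 : (Y.image sg).card ≤ (2 * Fintype.card (ι × Fin 5 × Bool) + 1) ^ (Module.finrank ℝ (Fin 4 → ℝ)) := by
    refine le_trans ?_ hcount
    rw [← Set.ncard_coe_finset]
    apply Set.ncard_le_ncard _ (Set.toFinite _)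
    intro s hs
    obtain ⟨y, -, rfl⟩ := Finset.mem_image.mp (Finset.mem_coe.mp hs)
    exact ⟨W y, rfl⟩
  refine (h1.trans h2).trans (le_of_eq ?_)
  simp only [Fintype.card_prod, Fintype.card_fin, Fintype.card_bool, Module.finrank_fintype_fun_eq_card]
  ring

theorem aVert_count {ι : Type*} [Fintype ι] (ℓ : ι → (Fin 4 → ℝ) →ₗ[ℝ] ℝ) (c : ι → ℝ) :
    {a | aVert ℓ c a}.Finite ∧ {a | aVert ℓ c a}.ncard ≤ (2 * Fintype.card ι + 1) ^ 4 := by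
  have hinj : Set.InjOn (aSg ℓ c) {a | aVert ℓ c a} := by
    intro x hx y hy hxy
    have : x - y = 0 := by
      apply hx
      intro i hi
      have h := congrFun hxy i
      simp only [aSg] at h
      rw [hi, sign_zero] at h
      have h' := sign_eq_zero_iff.mp h.symm
      rw [map_sub]; linarith
    exact sub_eq_zero.mp this
  have hmaps : Set.MapsTo (aSg ℓ c) {a | aVert ℓ c a}
      (Set.range (fun (v : Fin 4 → ℝ) (i : ι) => SignType.sign (ℓ i v + c i))) := fun x _ => ⟨x, rfl⟩
  have hfin : (Set.range (fun (v : Fin 4 → ℝ) (i : ι) => SignType.sign (ℓ i v + c i))).Finite := by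
    classical
    exact Set.toFinite _
  refine ⟨Set.Finite.of_injOn hmaps hinj hfin, ?_⟩
  refine (Set.ncard_le_ncard_of_injOn (aSg ℓ c) hmaps hinj hfin).trans ?_
  have := aux_signs ℓ c
  simpa using this

theorem aTau_zero {ι : Type*} [Fintype ι] {ℓ : ι → (Fin 4 → ℝ) →ₗ[ℝ] ℝ} {c : ι → ℝ}
    {y : Fin 4 → ℝ} (hy : aIn ℓ c y) (g : (Fin 4 → ℝ) →ₗ[ℝ] ℝ) (d : ℝ)
    (hn : ∀ j < 5, g (aTau ℓ c y j) + d = 0) : g y + d = 0 := by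
  have step : ∀ j < 5, g (aIter ℓ c y (j + 1)) + d = 0 → g (aIter ℓ c y j) + d = 0 := by
    intro j hj h
    obtain ⟨-, ⟨t, ht, h2⟩, -, -⟩ := aNext_spec (aIter_in hy j)
    rw [← aIter_succ] at h2
    have h6 := congrArg g h2
    simp only [map_add, map_smul, smul_eq_mul] at h6
    have h7 := hn j hj
    unfold aTau at h7
    have : (1 + t) * (g (aIter ℓ c y j) + d) = 0 := by linear_combination h6 + h + t * h7
    rcases mul_eq_zero.mp this with h8 | h8
    · linarith
    · exact h8
  have h4 : g (aIter ℓ c y 4) + d = 0 := by rw [aTau_last hy]; exact hn 4 (by norm_num)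
  exact step 0 (by norm_num) (step 1 (by norm_num) (step 2 (by norm_num) (step 3 (by norm_num) h4)))

theorem aux_class {α β : Type*} [DecidableEq α] (Y : Finset β) (U Z : Finset α) (X : β → Finset α)
    (K t : ℝ) (hK : 1 ≤ K) (ht : 2 * K ≤ t) (hU : (U.card : ℝ) ≤ t ^ 2 / (16 * K))
    (hX : ∀ y ∈ Y, X y ⊆ U ∪ Z) (hdeg : ∀ y ∈ Y, t ≤ (X y).card) (hZ : ∀ y ∈ Y, Z ⊆ X y)
    (hcod : ∀ y ∈ Y, ∀ y' ∈ Y, y ≠ y' → ((X y ∩ X y').card : ℝ) ≤ K) : (Y.card : ℝ) ≤ t := by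
  by_cases h1 : Y.card ≤ 1
  · have : (Y.card : ℝ) ≤ 1 := by exact_mod_cast h1
    linarith
  push Not at h1
  obtain ⟨y1, hy1, y2, hy2, h12⟩ := Finset.one_lt_card.mp h1
  have hZK : (Z.card : ℝ) ≤ K :=
    le_trans (by exact_mod_cast Finset.card_le_card (Finset.subset_inter (hZ y1 hy1) (hZ y2 hy2)))
      (hcod y1 hy1 y2 hy2 h12)
  have hk := aux_kst Y U (fun y => X y \ Z) K (by linarith)
    (by
      intro y hy i hi
      rw [Finset.mem_sdiff] at hi
      rcases Finset.mem_union.mp (hX y hy hi.1) with h | h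
      · exact h
      · exact absurd h hi.2)
    (by
      intro y hy y' hy' hne
      refine le_trans ?_ (hcod y hy y' hy' hne)
      exact_mod_cast Finset.card_le_card (Finset.inter_subset_inter Finset.sdiff_subset Finset.sdiff_subset))
  set s := ∑ y ∈ Y, ((X y \ Z).card : ℝ) with hs
  have hsl : Y.card * (t / 2) ≤ s := by
    rw [hs, ← nsmul_eq_mul, ← Finset.sum_const]
    apply Finset.sum_le_sum
    intro y hy
    have e : (X y \ Z).card + Z.card = (X y).card := Finset.card_sdiff_add_card_eq_card (hZ y hy)
    have e' : ((X y \ Z).card : ℝ) + Z.card = (X y).card := by exact_mod_cast e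
    have := hdeg y hy
    linarith
  set N : ℝ := (Y.card : ℝ) with hN
  have hN1 : 1 ≤ N := by rw [hN]; exact_mod_cast h1.le
  have hs0 : 0 < s := lt_of_lt_of_le (by nlinarith) hsl
  have hk2 : s ^ 2 ≤ t ^ 2 / (16 * K) * (s + K * N ^ 2) :=
    hk.trans (mul_le_mul_of_nonneg_right hU (add_nonneg hs0.le (mul_nonneg (by linarith) (sq_nonneg N))))
  have e1 : t ^ 2 / (16 * K) * (s + K * N ^ 2) = t ^ 2 / (16 * K) * s + t ^ 2 * N ^ 2 / 16 := by
    field_simp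
  have e2 : t ^ 2 / (16 * K) ≤ t ^ 2 / 16 := by
    apply div_le_div_of_nonneg_left (by positivity) (by norm_num) (by linarith)
  have e3 : t ^ 2 * N ^ 2 ≤ 4 * s ^ 2 := by
    have : (N * (t / 2)) ^ 2 ≤ s ^ 2 := pow_le_pow_left₀ (by nlinarith) hsl 2
    nlinarith
  rw [e1] at hk2
  have e4 : s ^ 2 * (3 / 4) ≤ t ^ 2 / 16 * s := by nlinarith
  have e5 : s * (3 / 4) ≤ t ^ 2 / 16 := by
    by_contra hc
    push Not at hc
    nlinarith
  have e6 : N * (t / 2) * (3 / 4) ≤ t ^ 2 / 16 := by linarith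
  have ht0 : 0 < t := by linarith
  by_contra hc
  push Not at hc
  nlinarith

set_option maxHeartbeats 400000 in
theorem aux_rich {γ : Type*} [DecidableEq γ] (ℓ : γ → (Fin 4 → ℝ) →ₗ[ℝ] ℝ) (c : γ → ℝ)
    (A Box : Finset γ) (hB : Box.card ≤ 8) (K t : ℝ) (hK : 1 ≤ K) (ht : 2 * K ≤ t)
    (Y : Finset (Fin 4 → ℝ))
    (hin : ∀ y ∈ Y, ∀ u : Fin 4 → ℝ, u ≠ 0 → ∃ i ∈ Box, ℓ i u < 0 ∧ 0 ≤ ℓ i y + c i)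
    (hdeg : ∀ y ∈ Y, t ≤ ((A.filter (fun i => ℓ i y + c i = 0)).card : ℝ))
    (hcod : ∀ y ∈ Y, ∀ y' ∈ Y, y ≠ y' →
      ((A.filter (fun i => ℓ i y + c i = 0) ∩ A.filter (fun i => ℓ i y' + c i = 0)).card : ℝ) ≤ K) :
    (Y.card : ℝ) ≤ t * (20 * ((A.card / (t ^ 2 / (16 * K))) *
      (20 * Real.log (2 * A.card + 17)) + 9) + 1) ^ 4 := by
  classical
  have ht0 : 0 < t := by linarith
  set D := t ^ 2 / (16 * K) with hD
  have hD0 : 0 < D := by positivity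
  obtain ⟨hVfin, hVcard⟩ := aVert_count (fun i : ↥(A ∪ Box) => ℓ i) (fun i : ↥(A ∪ Box) => c i)
  set Vt := hVfin.toFinset with hVt
  have hVc : Vt.card ≤ (2 * A.card + 17) ^ 4 := by
    have e : Vt.card = {a | aVert (fun i : ↥(A ∪ Box) => ℓ i) (fun i : ↥(A ∪ Box) => c i) a}.ncard :=
      (Set.ncard_eq_toFinset_card _ hVfin).symm
    rw [e]
    refine hVcard.trans (Nat.pow_le_pow_left ?_ 4)
    have := Finset.card_union_le A Box
    simp only [Fintype.card_coe]
    omega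
  set conf : (Fin 5 → Fin 4 → ℝ) → Finset γ := fun τ =>
    A.filter (fun i => ∃ j k, 0 < ℓ i (τ j) + c i ∧ ℓ i (τ k) + c i < 0) with hconf
  set Ω := (Fintype.piFinset (fun _ : Fin 5 => Vt)).filter (fun τ => D ≤ (conf τ).card) with hΩ
  have hΩc : Ω.card ≤ (2 * A.card + 17) ^ 20 := by
    refine (Finset.card_filter_le _ _).trans ?_
    rw [Fintype.card_piFinset]
    simp only [Finset.prod_const, Finset.card_univ, Fintype.card_fin]
    refine (Nat.pow_le_pow_left hVc 5).trans (le_of_eq ?_)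
    ring
  have hlog : Real.log Ω.card ≤ 20 * Real.log (2 * A.card + 17) := by
    have h1 : (1 : ℝ) ≤ 2 * A.card + 17 := by
      have : (0 : ℝ) ≤ (A.card : ℝ) := Nat.cast_nonneg _
      linarith
    rcases Nat.eq_zero_or_pos Ω.card with h0 | h0
    · rw [h0]
      simp only [Nat.cast_zero, Real.log_zero]
      have := Real.log_nonneg h1
      linarith
    · have h2 : (Ω.card : ℝ) ≤ (2 * A.card + 17) ^ 20 := by exact_mod_cast hΩc
      have h0' : (0 : ℝ) < (Ω.card : ℝ) := by exact_mod_cast h0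
      have h3 := Real.log_le_log h0' h2
      rw [Real.log_pow] at h3
      have e20 : ((20 : ℕ) : ℝ) = 20 := by norm_num
      rw [e20] at h3
      exact h3
  obtain ⟨R, hRA, hRc, hhit⟩ := aux_hit A D hD0 Ω conf (fun τ _ => Finset.filter_subset _ _)
    (fun τ hτ => (Finset.mem_filter.mp hτ).2)
  have hyin : ∀ y ∈ Y, aIn (fun i : ↥(R ∪ Box) => ℓ i) (fun i : ↥(R ∪ Box) => c i) y := by
    intro y hy u hu
    obtain ⟨i, hi, h⟩ := hin y hy u hu
    exact ⟨⟨i, Finset.mem_union_right _ hi⟩, h⟩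
  have hcount := aTau_count (fun i : ↥(R ∪ Box) => ℓ i) (fun i : ↥(R ∪ Box) => c i) Y hyin
  set T : (Fin 4 → ℝ) → (Fin 5 → Fin 4 → ℝ) := fun y j =>
    aTau (fun i : ↥(R ∪ Box) => ℓ i) (fun i : ↥(R ∪ Box) => c i) y j with hT
  have hfew : ∀ y ∈ Y, ((conf (T y)).card : ℝ) ≤ D := by
    intro y hy
    by_contra hc
    push Not at hc
    have hmem : T y ∈ Ω := by
      rw [hΩ, Finset.mem_filter, Fintype.mem_piFinset]
      refine ⟨fun j => ?_, hc.le⟩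
      rw [hVt, Set.Finite.mem_toFinset]
      intro u hu
      apply aTau_vert (hyin y hy) j u
      intro i hi
      have hi' : (i : γ) ∈ A ∪ Box := by
        rcases Finset.mem_union.mp i.2 with h | h
        · exact Finset.mem_union_left _ (hRA h)
        · exact Finset.mem_union_right _ h
      exact hu ⟨i, hi'⟩ hi
    obtain ⟨i, hiR, hi⟩ := hhit _ hmem
    obtain ⟨j, k, h1, h2⟩ := (Finset.mem_filter.mp hi).2
    exact aTau_noconflict (hyin y hy) ⟨i, Finset.mem_union_left _ hiR⟩ j k h1 h2
  have hfib : ∀ s ∈ Y.image T, ((Y.filter (fun y => T y = s)).card : ℝ) ≤ t := by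
    intro s _
    apply aux_class (Y.filter (fun y => T y = s)) (conf s) (A.filter (fun i => ∀ j, ℓ i (s j) + c i = 0))
      (fun y => A.filter (fun i => ℓ i y + c i = 0)) K t hK ht
    · rcases (Y.filter (fun y => T y = s)).eq_empty_or_nonempty with h | ⟨y, hy⟩
      · rename_i hs
        obtain ⟨y, hy, rfl⟩ := Finset.mem_image.mp hs
        exact hfew y hy
      · obtain ⟨hyY, rfl⟩ := Finset.mem_filter.mp hy
        exact hfew y hyY
    · intro y hy i hi
      obtain ⟨hyY, rfl⟩ := Finset.mem_filter.mp hy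
      obtain ⟨hiA, hi0⟩ := Finset.mem_filter.mp hi
      rw [Finset.mem_union, Finset.mem_filter, Finset.mem_filter]
      rcases aTau_conflict (hyin y hyY) (ℓ i) (c i) hi0 with h | ⟨j, hj, k, hk, h1, h2⟩
      · exact Or.inr ⟨hiA, fun j => h j j.2⟩
      · exact Or.inl ⟨hiA, ⟨j, hj⟩, ⟨k, hk⟩, h1, h2⟩
    · intro y hy
      exact hdeg y (Finset.mem_filter.mp hy).1
    · intro y hy i hi
      obtain ⟨hyY, rfl⟩ := Finset.mem_filter.mp hy
      obtain ⟨hiA, hi0⟩ := Finset.mem_filter.mp hi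
      exact Finset.mem_filter.mpr ⟨hiA, aTau_zero (hyin y hyY) (ℓ i) (c i) (fun j hj => hi0 ⟨j, hj⟩)⟩
    · intro y hy y' hy' hne
      exact hcod y (Finset.mem_filter.mp hy).1 y' (Finset.mem_filter.mp hy').1 hne
  have hq : ((Fintype.card ↥(R ∪ Box) : ℕ) : ℝ) ≤ (A.card / D) * (20 * Real.log (2 * A.card + 17)) + 9 := by
    have h1 : Fintype.card ↥(R ∪ Box) ≤ R.card + 8 := by
      have := Finset.card_union_le R Box
      simp only [Fintype.card_coe]
      omega
    have h2 : ((Fintype.card ↥(R ∪ Box) : ℕ) : ℝ) ≤ R.card + 8 := by exact_mod_cast h1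
    have h3 : (A.card / D) * Real.log Ω.card ≤ (A.card / D) * (20 * Real.log (2 * A.card + 17)) :=
      mul_le_mul_of_nonneg_left hlog (div_nonneg (Nat.cast_nonneg _) hD0.le)
    linarith
  have hYs : (Y.card : ℝ) = ∑ s ∈ Y.image T, ((Y.filter (fun y => T y = s)).card : ℝ) := by
    exact_mod_cast Finset.card_eq_sum_card_image T Y
  have hcount' : ((Y.image T).card : ℝ) ≤ (20 * ((Fintype.card ↥(R ∪ Box) : ℕ) : ℝ) + 1) ^ 4 := by
    exact_mod_cast hcount
  calc (Y.card : ℝ) ≤ ∑ s ∈ Y.image T, t := by rw [hYs]; exact Finset.sum_le_sum hfib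
    _ = (Y.image T).card * t := by rw [Finset.sum_const, nsmul_eq_mul]
    _ ≤ (20 * ((Fintype.card ↥(R ∪ Box) : ℕ) : ℝ) + 1) ^ 4 * t := mul_le_mul_of_nonneg_right hcount' ht0.le
    _ ≤ (20 * ((A.card / D) * (20 * Real.log (2 * A.card + 17)) + 9) + 1) ^ 4 * t := by
      apply mul_le_mul_of_nonneg_right _ ht0.le
      apply pow_le_pow_left₀ (add_nonneg (mul_nonneg (by norm_num) (Nat.cast_nonneg _)) zero_le_one)
      linarith
    _ = _ := by ring

/-- the functionals used for the lattice problem -/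
def latL (i : (Fin 4 → ℤ) ⊕ (Fin 4 × Bool)) : (Fin 4 → ℝ) →ₗ[ℝ] ℝ :=
  match i with
  | Sum.inl x => ∑ k, (2 * (x k : ℝ)) • LinearMap.proj k
  | Sum.inr (k, true) => LinearMap.proj k
  | Sum.inr (k, false) => -LinearMap.proj k

/-- the constants of the functionals -/
def latC (i : (Fin 4 → ℤ) ⊕ (Fin 4 × Bool)) : ℝ :=
  match i with
  | Sum.inl _ => -1
  | Sum.inr _ => 1

/-- inversion of a lattice point -/
def latPt (n : Fin 4 → ℤ) : Fin 4 → ℝ := fun k => (n k : ℝ) / ((∑ t, n t ^ 2 : ℤ) : ℝ)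

theorem lat_norm_pos {n : Fin 4 → ℤ} (hn : n ≠ 0) : (1 : ℤ) ≤ ∑ t, n t ^ 2 := by
  have h0 : ∑ t, n t ^ 2 ≠ 0 := by
    intro h
    apply hn
    funext t
    have := (Finset.sum_eq_zero_iff_of_nonneg (fun i _ => sq_nonneg (n i))).mp h t (Finset.mem_univ t)
    simpa using this
  have h1 : 0 ≤ ∑ t, n t ^ 2 := Finset.sum_nonneg fun i _ => sq_nonneg (n i)
  omega

theorem latPt_inj {n n' : Fin 4 → ℤ} (hn : n ≠ 0) (hn' : n' ≠ 0) (h : latPt n = latPt n') : n = n' := by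
  have h1 : (1 : ℝ) ≤ ((∑ t, n t ^ 2 : ℤ) : ℝ) := by exact_mod_cast lat_norm_pos hn
  have h2 : (1 : ℝ) ≤ ((∑ t, n' t ^ 2 : ℤ) : ℝ) := by exact_mod_cast lat_norm_pos hn'
  have sq : ∀ m : Fin 4 → ℤ, m ≠ 0 → ∑ k, latPt m k ^ 2 = 1 / ((∑ t, m t ^ 2 : ℤ) : ℝ) := by
    intro m hm
    have h3 : (1 : ℝ) ≤ ((∑ t, m t ^ 2 : ℤ) : ℝ) := by exact_mod_cast lat_norm_pos hm
    unfold latPt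
    simp only [div_pow]
    rw [← Finset.sum_div, div_eq_div_iff (by positivity) (by positivity)]
    push_cast
    ring
  have h4 := sq n hn
  rw [h, sq n' hn'] at h4
  have h5 : ((∑ t, n t ^ 2 : ℤ) : ℝ) = ((∑ t, n' t ^ 2 : ℤ) : ℝ) := by
    rw [div_eq_div_iff (by positivity) (by positivity)] at h4
    linarith
  funext k
  have h6 := congrFun h k
  unfold latPt at h6
  rw [h5, div_left_inj' (by positivity)] at h6
  exact_mod_cast h6

theorem lat_inc {n : Fin 4 → ℤ} (hn : n ≠ 0) (x : Fin 4 → ℤ) :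
    latL (Sum.inl x) (latPt n) + latC (Sum.inl x) = 0 ↔ 2 * ∑ t, x t * n t = ∑ t, n t ^ 2 := by
  have h1 : (1 : ℝ) ≤ ((∑ t, n t ^ 2 : ℤ) : ℝ) := by exact_mod_cast lat_norm_pos hn
  have e : latL (Sum.inl x) (latPt n) = ((2 * ∑ t, x t * n t : ℤ) : ℝ) / ((∑ t, n t ^ 2 : ℤ) : ℝ) := by
    simp only [latL, latPt, LinearMap.sum_apply, LinearMap.smul_apply, LinearMap.proj_apply, smul_eq_mul]
    rw [eq_div_iff (by positivity), Finset.sum_mul]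
    push_cast
    rw [Finset.mul_sum]
    refine Finset.sum_congr rfl fun k _ => ?_
    push_cast at h1
    have : (∑ t, (n t : ℝ) ^ 2) ≠ 0 := by linarith
    field_simp
  rw [e]
  simp only [latC]
  rw [← sub_eq_add_neg, sub_eq_zero, div_eq_one_iff_eq (by positivity)]
  norm_cast

theorem lat_rich (A Y : Finset (Fin 4 → ℤ)) (K t : ℝ) (hK : 1 ≤ K) (ht : 2 * K ≤ t)
    (hY0 : ∀ n ∈ Y, n ≠ 0)
    (hdeg : ∀ n ∈ Y, t ≤ ((A.filter (fun x => 2 * ∑ t, x t * n t = ∑ t, n t ^ 2)).card : ℝ))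
    (hcod : ∀ n ∈ Y, ∀ n' ∈ Y, n ≠ n' →
      ((A.filter (fun x => 2 * ∑ t, x t * n t = ∑ t, n t ^ 2) ∩
        A.filter (fun x => 2 * ∑ t, x t * n' t = ∑ t, n' t ^ 2)).card : ℝ) ≤ K) :
    (Y.card : ℝ) ≤ t * (20 * ((A.card / (t ^ 2 / (16 * K))) *
      (20 * Real.log (2 * A.card + 17)) + 9) + 1) ^ 4 := by
  classical
  have hinj : Function.Injective (Sum.inl : (Fin 4 → ℤ) → (Fin 4 → ℤ) ⊕ (Fin 4 × Bool)) := Sum.inl_injective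
  set A' := A.map ⟨Sum.inl, hinj⟩ with hA'
  have hA'c : A'.card = A.card := Finset.card_map _
  have hfil : ∀ n ∈ Y, A'.filter (fun i => latL i (latPt n) + latC i = 0) =
      (A.filter (fun x => 2 * ∑ t, x t * n t = ∑ t, n t ^ 2)).map ⟨Sum.inl, hinj⟩ := by
    intro n hn
    rw [hA', Finset.filter_map]
    congr 1
    apply Finset.filter_congr
    intro x _
    exact lat_inc (hY0 n hn) x
  have hYc : (Y.image latPt).card = Y.card := by
    apply Finset.card_image_of_injOn
    intro n hn n' hn' h
    exact latPt_inj (hY0 n hn) (hY0 n' hn') h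
  rw [← hYc, ← hA'c]
  apply aux_rich latL latC A' ((Finset.univ : Finset (Fin 4 × Bool)).map ⟨Sum.inr, Sum.inr_injective⟩)
    (by rw [Finset.card_map]; decide) K t hK ht (Y.image latPt)
  · intro y hy u hu
    obtain ⟨n, hn, rfl⟩ := Finset.mem_image.mp hy
    obtain ⟨k, hk⟩ : ∃ k, u k ≠ 0 := by
      by_contra h; push Not at h; exact hu (funext h)
    have h1 : (1 : ℝ) ≤ ((∑ t, n t ^ 2 : ℤ) : ℝ) := by exact_mod_cast lat_norm_pos (hY0 n hn)
    have h2 : |latPt n k| ≤ 1 := by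
      unfold latPt
      rw [abs_div, abs_of_pos (show (0 : ℝ) < ((∑ t, n t ^ 2 : ℤ) : ℝ) by linarith), div_le_one (by linarith)]
      have h3 : n k ^ 2 ≤ ∑ t, n t ^ 2 :=
        Finset.single_le_sum (f := fun t => n t ^ 2) (fun i _ => sq_nonneg (n i)) (Finset.mem_univ k)
      have h4 : |n k| ≤ n k ^ 2 := by
        rw [← sq_abs]
        rcases eq_or_lt_of_le (abs_nonneg (n k)) with h | h
        · rw [← h]; norm_num
        · nlinarith
      exact_mod_cast h4.trans h3
    have h2' := abs_le.mp h2
    rcases lt_or_gt_of_ne hk with h | h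
    · refine ⟨Sum.inr (k, true), by simp, ?_, ?_⟩
      · simpa [latL] using h
      · simp only [latL, latC, LinearMap.proj_apply]; linarith
    · refine ⟨Sum.inr (k, false), by simp, ?_, ?_⟩
      · simpa [latL] using h
      · simp only [latL, latC, LinearMap.neg_apply, LinearMap.proj_apply]; linarith
  · intro y hy
    obtain ⟨n, hn, rfl⟩ := Finset.mem_image.mp hy
    rw [hfil n hn, Finset.card_map]
    exact hdeg n hn
  · intro y hy y' hy' hne
    obtain ⟨n, hn, rfl⟩ := Finset.mem_image.mp hy
    obtain ⟨n', hn', rfl⟩ := Finset.mem_image.mp hy'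
    rw [hfil n hn, hfil n' hn', ← Finset.map_inter, Finset.card_map]
    exact hcod n hn n' hn' (fun h => hne (by rw [h]))

theorem lat_rich' (A Y : Finset (Fin 4 → ℤ)) (K t G : ℝ) (hK : 1 ≤ K) (ht : 2 * K ≤ t)
    (ht2 : t ^ 2 ≤ 4 * K * A.card) (hG : G = 320 * (20 * Real.log (2 * A.card + 17)) + 724)
    (hY0 : ∀ n ∈ Y, n ≠ 0)
    (hdeg : ∀ n ∈ Y, t ≤ ((A.filter (fun x => 2 * ∑ t, x t * n t = ∑ t, n t ^ 2)).card : ℝ))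
    (hcod : ∀ n ∈ Y, ∀ n' ∈ Y, n ≠ n' →
      ((A.filter (fun x => 2 * ∑ t, x t * n t = ∑ t, n t ^ 2) ∩
        A.filter (fun x => 2 * ∑ t, x t * n' t = ∑ t, n' t ^ 2)).card : ℝ) ≤ K) :
    (Y.card : ℝ) * t ^ 7 ≤ (K * G) ^ 4 * (A.card : ℝ) ^ 4 := by
  have h := lat_rich A Y K t hK ht hY0 hdeg hcod
  have hP0 : (0 : ℝ) ≤ (A.card : ℝ) := Nat.cast_nonneg _
  have hl0 : 0 ≤ Real.log (2 * (A.card : ℝ) + 17) := Real.log_nonneg (by linarith)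
  generalize Real.log (2 * (A.card : ℝ) + 17) = l at *
  generalize (A.card : ℝ) = P at *
  generalize (Y.card : ℝ) = y at *
  have ht0 : 0 < t := by linarith
  have e1 : 20 * ((P / (t ^ 2 / (16 * K))) * (20 * l) + 9) + 1 ≤ K * G * P / t ^ 2 := by
    rw [le_div_iff₀ (by positivity)]
    have : P / (t ^ 2 / (16 * K)) = 16 * K * P / t ^ 2 := by field_simp
    rw [this, hG]
    have e2 : (20 * (16 * K * P / t ^ 2 * (20 * l) + 9) + 1) * t ^ 2 = 320 * K * P * (20 * l) + 181 * t ^ 2 := by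
      field_simp; ring
    rw [e2]
    nlinarith
  have e3 : (20 * ((P / (t ^ 2 / (16 * K))) * (20 * l) + 9) + 1) ^ 4 ≤ (K * G * P / t ^ 2) ^ 4 :=
    pow_le_pow_left₀ (by positivity) e1 4
  calc y * t ^ 7 ≤ (t * (K * G * P / t ^ 2) ^ 4) * t ^ 7 := by
        apply mul_le_mul_of_nonneg_right _ (by positivity)
        exact h.trans (mul_le_mul_of_nonneg_left e3 ht0.le)
    _ = _ := by field_simp

theorem aux_class_energy {β : Type*} (N : Finset β) (r d : β → ℝ) (t K G W ρ s : ℝ)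
    (hK : 1 ≤ K) (hKW : K ≤ W) (hG0 : 0 ≤ G) (hGW : G ≤ W) (hρ : 1 ≤ ρ) (ht : 1 ≤ t)
    (hr0 : ∀ n ∈ N, 0 ≤ r n) (hrd : ∀ n ∈ N, r n ≤ d n) (hdt : ∀ n ∈ N, t ≤ d n)
    (hd2 : ∀ n ∈ N, d n ≤ 2 * t) (hrs : ∀ n ∈ N, r n ≤ s) (hrP : ∀ n ∈ N, r n ≤ ρ ^ 3)
    (hR : ∑ n ∈ N, r n ≤ ρ ^ 6)
    (hrich : 2 * K ≤ t → t ^ 2 ≤ 4 * K * ρ ^ 3 → (N.card : ℝ) * t ^ 7 ≤ (K * G) ^ 4 * (ρ ^ 3) ^ 4)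
    (hkst : (∑ n ∈ N, d n) ^ 2 ≤ ρ ^ 3 * ((∑ n ∈ N, d n) + K * (N.card : ℝ) ^ 2)) :
    ∑ n ∈ N, r n ^ 2 ≤ 8 * W ^ 8 * ρ ^ 7 ∧
    ∑ n ∈ N, r n ^ 3 ≤ 16 * W ^ 8 * (ρ ^ 8 + ρ ^ 3 * s ^ 2) := by
  have hW : 1 ≤ W := hK.trans hKW
  have hρ0 : 0 < ρ := by linarith
  have hW8 : 1 ≤ W ^ 8 := one_le_pow₀ hW
  have hKW8 : K ≤ W ^ 8 := hKW.trans (by simpa using pow_le_pow_right₀ hW (show 1 ≤ 8 by norm_num))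
  have hK2W8 : K ^ 2 ≤ W ^ 8 := (pow_le_pow_left₀ (by linarith) hKW 2).trans
    (pow_le_pow_right₀ hW (by norm_num))
  have h67 : ρ ^ 6 ≤ ρ ^ 7 := pow_le_pow_right₀ hρ (by norm_num)
  have h68 : ρ ^ 6 ≤ ρ ^ 8 := pow_le_pow_right₀ hρ (by norm_num)
  have hR0 : 0 ≤ ∑ n ∈ N, r n := Finset.sum_nonneg hr0
  have mulsum : ∀ B : ℝ, (∀ n ∈ N, r n ≤ B) → ∑ n ∈ N, r n ^ 2 ≤ B * ∑ n ∈ N, r n := by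
    intro B hB
    rw [Finset.mul_sum]
    refine Finset.sum_le_sum fun n hn => ?_
    rw [sq]
    exact mul_le_mul_of_nonneg_right (hB n hn) (hr0 n hn)
  have mulsum3 : ∀ B : ℝ, (∀ n ∈ N, r n ≤ B) → ∑ n ∈ N, r n ^ 3 ≤ B ^ 2 * ∑ n ∈ N, r n := by
    intro B hB
    rw [Finset.mul_sum]
    refine Finset.sum_le_sum fun n hn => ?_
    rw [pow_succ]
    exact mul_le_mul_of_nonneg_right (pow_le_pow_left₀ (hr0 n hn) (hB n hn) 2) (hr0 n hn)
  have hr2t : ∀ n ∈ N, r n ≤ 2 * t := fun n hn => (hrd n hn).trans (hd2 n hn)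
  have small : ∀ B : ℝ, 0 ≤ B → t ≤ B → ∑ n ∈ N, r n ^ 2 ≤ 2 * B * ρ ^ 6 ∧
      ∑ n ∈ N, r n ^ 3 ≤ 4 * B ^ 2 * ρ ^ 6 := by
    intro B hB0 hB
    have hrB : ∀ n ∈ N, r n ≤ 2 * B := fun n hn => (hr2t n hn).trans (by linarith)
    constructor
    · exact (mulsum _ hrB).trans (mul_le_mul_of_nonneg_left hR (by positivity))
    · refine (mulsum3 _ hrB).trans ?_
      have : 4 * B ^ 2 = (2 * B) ^ 2 := by ring
      rw [this]
      exact mul_le_mul_of_nonneg_left hR (by positivity)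
  have hs2 : 0 ≤ ρ ^ 3 * s ^ 2 := by positivity
  have hbig : ∀ x : ℝ, x ≤ 16 * W ^ 8 * ρ ^ 8 → x ≤ 16 * W ^ 8 * (ρ ^ 8 + ρ ^ 3 * s ^ 2) := by
    intro x hx
    have : 0 ≤ 16 * W ^ 8 * (ρ ^ 3 * s ^ 2) := by positivity
    linarith
  by_cases h1 : t < 2 * K
  · obtain ⟨a1, a2⟩ := small (2 * K) (by linarith) h1.le
    constructor
    · refine a1.trans ?_
      have : K * ρ ^ 6 ≤ W ^ 8 * ρ ^ 7 := mul_le_mul hKW8 h67 (by positivity) (by positivity)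
      have h0 : 0 ≤ W ^ 8 * ρ ^ 7 := by positivity
      linarith
    · apply hbig
      refine a2.trans ?_
      have : K ^ 2 * ρ ^ 6 ≤ W ^ 8 * ρ ^ 8 := mul_le_mul hK2W8 h68 (by positivity) (by positivity)
      linarith
  push Not at h1
  by_cases h2 : t ^ 2 ≤ 4 * K * ρ ^ 3
  · by_cases h3 : t ≤ ρ
    · obtain ⟨a1, a2⟩ := small ρ hρ0.le h3
      constructor
      · refine a1.trans ?_
        have : 1 * ρ ^ 7 ≤ W ^ 8 * ρ ^ 7 := mul_le_mul_of_nonneg_right hW8 (by positivity)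
        nlinarith
      · apply hbig
        refine a2.trans ?_
        have : 1 * ρ ^ 8 ≤ W ^ 8 * ρ ^ 8 := mul_le_mul_of_nonneg_right hW8 (by positivity)
        nlinarith
    · push Not at h3
      have hq := hrich h1 h2
      have hKG : (K * G) ^ 4 ≤ W ^ 8 := by
        have : K * G ≤ W * W := mul_le_mul hKW hGW hG0 (by linarith)
        calc (K * G) ^ 4 ≤ (W * W) ^ 4 := pow_le_pow_left₀ (by positivity) this 4
          _ = W ^ 8 := by ring
      have hq2 : (N.card : ℝ) * t ^ 7 ≤ W ^ 8 * ρ ^ 12 := by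
        refine hq.trans ?_
        have : (ρ ^ 3) ^ 4 = ρ ^ 12 := by ring
        rw [this]
        exact mul_le_mul_of_nonneg_right hKG (by positivity)
      have hN0 : (0 : ℝ) ≤ (N.card : ℝ) := Nat.cast_nonneg _
      have b2 : (N.card : ℝ) * t ^ 2 ≤ W ^ 8 * ρ ^ 7 := by
        have h5 : ρ ^ 5 ≤ t ^ 5 := pow_le_pow_left₀ hρ0.le h3.le 5
        have : ((N.card : ℝ) * t ^ 2) * ρ ^ 5 ≤ (W ^ 8 * ρ ^ 7) * ρ ^ 5 :=
          calc ((N.card : ℝ) * t ^ 2) * ρ ^ 5 ≤ ((N.card : ℝ) * t ^ 2) * t ^ 5 :=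
                mul_le_mul_of_nonneg_left h5 (mul_nonneg hN0 (by positivity))
            _ = (N.card : ℝ) * t ^ 7 := by ring
            _ ≤ _ := hq2
            _ = _ := by ring
        exact le_of_mul_le_mul_right this (by positivity)
      have b3 : (N.card : ℝ) * t ^ 3 ≤ W ^ 8 * ρ ^ 8 := by
        have h5 : ρ ^ 4 ≤ t ^ 4 := pow_le_pow_left₀ hρ0.le h3.le 4
        have : ((N.card : ℝ) * t ^ 3) * ρ ^ 4 ≤ (W ^ 8 * ρ ^ 8) * ρ ^ 4 :=
          calc ((N.card : ℝ) * t ^ 3) * ρ ^ 4 ≤ ((N.card : ℝ) * t ^ 3) * t ^ 4 :=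
                mul_le_mul_of_nonneg_left h5 (mul_nonneg hN0 (by positivity))
            _ = (N.card : ℝ) * t ^ 7 := by ring
            _ ≤ _ := hq2
            _ = _ := by ring
        exact le_of_mul_le_mul_right this (by positivity)
      have c : ∀ k : ℕ, ∑ n ∈ N, r n ^ k ≤ N.card * (2 * t) ^ k := by
        intro k
        rw [← nsmul_eq_mul, ← Finset.sum_const]
        exact Finset.sum_le_sum fun n hn => pow_le_pow_left₀ (hr0 n hn) (hr2t n hn) k
      constructor
      · refine (c 2).trans ?_
        have h0 : 0 ≤ W ^ 8 * ρ ^ 7 := by positivity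
        nlinarith
      · apply hbig
        refine (c 3).trans ?_
        have h0 : 0 ≤ W ^ 8 * ρ ^ 8 := by positivity
        nlinarith
  · push Not at h2
    set S := ∑ n ∈ N, d n with hS
    have hNt : (N.card : ℝ) * t ≤ S := by
      rw [hS, ← nsmul_eq_mul, ← Finset.sum_const]
      exact Finset.sum_le_sum hdt
    have hN0 : (0 : ℝ) ≤ (N.card : ℝ) := Nat.cast_nonneg _
    generalize (N.card : ℝ) = M at *
    have hS0 : 0 ≤ S := (mul_nonneg hN0 (by linarith)).trans hNt
    have hS43 : S ≤ 4 / 3 * ρ ^ 3 := by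
      have e1 : (M * t) ^ 2 ≤ S ^ 2 := pow_le_pow_left₀ (mul_nonneg hN0 (by linarith)) hNt 2
      have e2 : 4 * K * ρ ^ 3 * M ^ 2 ≤ t ^ 2 * M ^ 2 := mul_le_mul_of_nonneg_right h2.le (sq_nonneg _)
      have e3 : S ^ 2 * (3 / 4) ≤ ρ ^ 3 * S := by nlinarith
      by_contra hc
      push Not at hc
      have : 0 < ρ ^ 3 := by positivity
      nlinarith
    have hRS : ∑ n ∈ N, r n ≤ S := Finset.sum_le_sum hrd
    constructor
    · refine (mulsum _ hrP).trans ?_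
      have e1 : ρ ^ 3 * ∑ n ∈ N, r n ≤ ρ ^ 3 * (4 / 3 * ρ ^ 3) :=
        mul_le_mul_of_nonneg_left (hRS.trans hS43) (by positivity)
      have e2 : 1 * ρ ^ 7 ≤ W ^ 8 * ρ ^ 7 := mul_le_mul_of_nonneg_right hW8 (by positivity)
      nlinarith
    · refine (mulsum3 _ hrs).trans ?_
      have e1 : s ^ 2 * ∑ n ∈ N, r n ≤ s ^ 2 * (4 / 3 * ρ ^ 3) :=
        mul_le_mul_of_nonneg_left (hRS.trans hS43) (sq_nonneg _)
      have e2 : 1 * (ρ ^ 3 * s ^ 2) ≤ W ^ 8 * (ρ ^ 3 * s ^ 2) := mul_le_mul_of_nonneg_right hW8 hs2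
      have e3 : 0 ≤ W ^ 8 * ρ ^ 8 := by positivity
      nlinarith

def repF (F : Finset (Fin 4 → ℤ)) (n : Fin 4 → ℤ) : Finset ((Fin 4 → ℤ) × (Fin 4 → ℤ)) :=
  (F ×ˢ F).filter (fun p => p.1 + p.2 = n)

def degF (F : Finset (Fin 4 → ℤ)) (n : Fin 4 → ℤ) : Finset (Fin 4 → ℤ) :=
  F.filter (fun x => 2 * ∑ t, x t * n t = ∑ t, n t ^ 2)

def sumF (F : Finset (Fin 4 → ℤ)) : Finset (Fin 4 → ℤ) :=
  (F ×ˢ F).image (fun p => p.1 + p.2)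

lemma repCount_eq_repF (F : Finset (Fin 4 → ℤ)) (n : Fin 4 → ℤ) :
    repCount 2 (F : Set (Fin 4 → ℤ)) n = (repF F n).card := by
  unfold repCount
  rw [← Fintype.card_coe, ← Nat.card_eq_fintype_card]
  refine Nat.card_congr ((finTwoArrowEquiv (Fin 4 → ℤ)).subtypeEquiv ?_)
  intro f
  simp [repF, Fin.forall_fin_two, Fin.sum_univ_two]

lemma sum_repF (F : Finset (Fin 4 → ℤ)) :
    ∑ n ∈ sumF F, (repF F n).card = F.card ^ 2 := by
  have := Finset.card_eq_sum_card_image (fun p : (Fin 4 → ℤ) × (Fin 4 → ℤ) => p.1 + p.2) (F ×ˢ F)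
  rw [Finset.card_product] at this
  rw [sq, this]
  rfl

lemma repF_pos (F : Finset (Fin 4 → ℤ)) (n : Fin 4 → ℤ) (hn : n ∈ sumF F) :
    1 ≤ (repF F n).card := by
  rw [Nat.one_le_iff_ne_zero, Finset.card_ne_zero]
  obtain ⟨p, hp, rfl⟩ := Finset.mem_image.1 hn
  exact ⟨p, Finset.mem_filter.2 ⟨hp, rfl⟩⟩

lemma repF_le_degF (F : Finset (Fin 4 → ℤ)) (m : ℤ) (hF : ∀ x ∈ F, ∑ t, x t ^ 2 = m)
    (n : Fin 4 → ℤ) : (repF F n).card ≤ (degF F n).card := by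
  refine Finset.card_le_card_of_injOn (fun p => p.1) ?_ ?_
  · intro p hp
    have hp' : p ∈ repF F n := hp
    simp only [repF, Finset.mem_filter, Finset.mem_product] at hp'
    obtain ⟨⟨h1, h2⟩, h3⟩ := hp'
    show p.1 ∈ degF F n
    refine Finset.mem_filter.2 ⟨h1, ?_⟩
    have e1 := hF _ h1
    have e2 := hF _ h2
    subst h3
    simp only [Fin.sum_univ_four, Pi.add_apply] at *
    linarith
  · intro p hp q hq h
    have hp' : p ∈ repF F n := hp
    have hq' : q ∈ repF F n := hq
    simp only [repF, Finset.mem_filter] at hp' hq'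
    have h' : p.1 = q.1 := h
    refine Prod.ext h' ?_
    have := hp'.2.trans hq'.2.symm
    rw [h'] at this
    exact add_left_cancel this

lemma degF_le (F : Finset (Fin 4 → ℤ)) (n : Fin 4 → ℤ) : (degF F n).card ≤ F.card :=
  Finset.card_filter_le _ _

lemma multiEnergy_le (F : Finset (Fin 4 → ℤ)) (k : ℕ) :
    multiEnergy 2 (k + 1) (F : Set (Fin 4 → ℤ)) ≤ ∑ n ∈ sumF F, (repF F n).card ^ (k + 1) := by
  have hc : ((sumF F).sigma (fun n => Fintype.piFinset (fun _ : Fin (k + 1) => repF F n))).card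
      = ∑ n ∈ sumF F, (repF F n).card ^ (k + 1) := by
    rw [Finset.card_sigma]
    refine Finset.sum_congr rfl fun n _ => ?_
    rw [Fintype.card_piFinset]
    simp
  rw [← hc, ← Fintype.card_coe, ← Nat.card_eq_fintype_card]
  unfold multiEnergy
  refine Nat.card_le_card_of_injective
    (fun f => ⟨⟨∑ i, f.1 0 i, fun j => (f.1 j 0, f.1 j 1)⟩, ?_⟩) ?_
  · obtain ⟨f, h1, h2⟩ := f
    rw [Finset.mem_sigma]
    refine ⟨Finset.mem_image.2 ⟨(f 0 0, f 0 1), ?_, ?_⟩, ?_⟩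
    · exact Finset.mem_product.2 ⟨h1 0 0, h1 0 1⟩
    · simp [Fin.sum_univ_two]
    · rw [Fintype.mem_piFinset]
      intro j
      refine Finset.mem_filter.2 ⟨Finset.mem_product.2 ⟨h1 j 0, h1 j 1⟩, ?_⟩
      have := h2 j 0
      rw [Fin.sum_univ_two] at this
      exact this
  · intro f g h
    have h' := congrArg (fun z => z.1.2) h
    simp only at h'
    apply Subtype.ext
    funext j i
    have := congrFun h' j
    rw [Prod.mk.injEq] at this
    fin_cases i
    · exact this.1
    · exact this.2

lemma abs_le_of_norm (m : ℕ) (x : Fin 4 → ℤ) (hx : ∑ t, x t ^ 2 = (m : ℤ)) (t : Fin 4) :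
    |x t| ≤ m := by
  have h1 : x t ^ 2 ≤ ∑ t, x t ^ 2 :=
    Finset.single_le_sum (f := fun t => x t ^ 2) (fun i _ => sq_nonneg _) (Finset.mem_univ t)
  rw [hx] at h1
  refine le_trans ?_ h1
  rw [← sq_abs]
  exact Int.le_self_sq _

lemma card_le_box (m : ℕ) (F : Finset (Fin 4 → ℤ)) (hF : ∀ x ∈ F, ∑ t, x t ^ 2 = (m : ℤ)) :
    F.card ≤ (2 * m + 1) ^ 4 := by
  have hs : F ⊆ Fintype.piFinset (fun _ : Fin 4 => Finset.Icc (-(m : ℤ)) m) := by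
    intro x hx
    rw [Fintype.mem_piFinset]
    intro t
    rw [Finset.mem_Icc]
    exact abs_le.1 (abs_le_of_norm m x (hF x hx) t)
  refine (Finset.card_le_card hs).trans ?_
  rw [Fintype.card_piFinset]
  simp only [Int.card_Icc, Finset.prod_const, Finset.card_univ, Fintype.card_fin]
  refine Nat.pow_le_pow_left ?_ 4
  omega

/-- Energies from the class bounds. -/
lemma lat_energy (m : ℕ)
    (K W ρ s : ℝ) (hK : 1 ≤ K)
    (F : Finset (Fin 4 → ℤ)) (hF : ∀ x ∈ F, ∑ t, x t ^ 2 = (m : ℤ)) (hFne : F.Nonempty)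
    (hcirc : ∀ n n' : Fin 4 → ℤ, n ≠ 0 → n' ≠ 0 → n ≠ n' →
      (∀ t, |n t| ≤ 2 * m) → (∀ t, |n' t| ≤ 2 * m) → ∀ S : Finset (Fin 4 → ℤ),
      (∀ x ∈ S, ∑ t, x t ^ 2 = (m : ℤ) ∧ 2 * ∑ t, x t * n t = ∑ t, n t ^ 2 ∧
        2 * ∑ t, x t * n' t = ∑ t, n' t ^ 2) → (S.card : ℝ) ≤ K)
    (hKW : K ≤ W) (hGW : 320 * (20 * Real.log (2 * F.card + 17)) + 724 ≤ W)
    (hρ : 1 ≤ ρ) (hρF : ρ ^ 3 = F.card)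
    (hs : ∀ n, ((repF F n).card : ℝ) ≤ s) :
    (∑ n ∈ sumF F, ((repF F n).card : ℝ) ^ 2 ≤ 9 * W ^ 9 * ρ ^ 7) ∧
    (∑ n ∈ sumF F, ((repF F n).card : ℝ) ^ 3 ≤ 17 * W ^ 9 * (ρ ^ 8 + ρ ^ 3 * s ^ 2)) := by
  have hW1 : 1 ≤ W := hK.trans hKW
  have hlogpos : 0 ≤ Real.log (2 * (F.card : ℝ) + 17) :=
    Real.log_nonneg (by have : (0:ℝ) ≤ F.card := Nat.cast_nonneg _; linarith)
  set G : ℝ := 320 * (20 * Real.log (2 * F.card + 17)) + 724 with hGdef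
  have hG0 : 0 ≤ G := by rw [hGdef]; linarith
  set L : ℕ := Nat.log 2 F.card + 1 with hL
  have hP0 : F.card ≠ 0 := Finset.card_ne_zero.2 hFne
  have hLW : (L : ℝ) ≤ W := by
    refine le_trans ?_ hGW
    have h1 : ((2:ℕ) ^ (Nat.log 2 F.card) : ℕ) ≤ F.card := Nat.pow_log_le_self 2 hP0
    have h2 : ((2:ℝ)) ^ (Nat.log 2 F.card) ≤ 2 * F.card + 17 := by
      have : (((2:ℕ) ^ (Nat.log 2 F.card) : ℕ) : ℝ) ≤ F.card := by exact_mod_cast h1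
      push_cast at this
      have : (0:ℝ) ≤ F.card := Nat.cast_nonneg _
      linarith
    have h3 := Real.log_le_log (by positivity) h2
    rw [Real.log_pow] at h3
    have h4 := Real.log_two_gt_d9
    have h5 : (0:ℝ) ≤ (Nat.log 2 F.card : ℕ) := Nat.cast_nonneg _
    have h6 : ((Nat.log 2 F.card : ℕ) : ℝ) * (1/2) ≤ (Nat.log 2 F.card : ℕ) * Real.log 2 :=
      mul_le_mul_of_nonneg_left (by linarith) h5
    rw [hL, hGdef]
    push_cast
    linarith
  have hs0 : 0 ≤ s := (Nat.cast_nonneg _).trans (hs 0)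
  have hρ0 : 0 ≤ ρ := by linarith
  have hW0 : 0 ≤ W := by linarith
  set N : Finset (Fin 4 → ℤ) := (sumF F).erase 0 with hN
  have hNmem : ∀ n ∈ N, n ≠ 0 ∧ n ∈ sumF F := fun n hn => Finset.mem_erase.1 hn
  have hbox : ∀ n ∈ N, ∀ t, |n t| ≤ 2 * m := by
    intro n hn t
    obtain ⟨p, hp, rfl⟩ := Finset.mem_image.1 (hNmem n hn).2
    rw [Finset.mem_product] at hp
    have a1 := abs_le_of_norm m p.1 (hF _ hp.1) t
    have a2 := abs_le_of_norm m p.2 (hF _ hp.2) t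
    have := abs_add_le (p.1 t) (p.2 t)
    simp only [Pi.add_apply]
    linarith
  have hcod : ∀ n ∈ N, ∀ n' ∈ N, n ≠ n' → ((degF F n ∩ degF F n').card : ℝ) ≤ K := by
    intro n hn n' hn' hne
    refine hcirc n n' (hNmem n hn).1 (hNmem n' hn').1 hne (hbox n hn) (hbox n' hn') _ ?_
    intro x hx
    rw [Finset.mem_inter] at hx
    have h1 := Finset.mem_filter.1 hx.1
    have h2 := Finset.mem_filter.1 hx.2
    exact ⟨hF x h1.1, h1.2, h2.2⟩
  have hrP : ∀ n, ((repF F n).card : ℝ) ≤ ρ ^ 3 := by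
    intro n
    rw [hρF]
    exact_mod_cast (repF_le_degF F m hF n).trans (degF_le F n)
  have hsumsq : ∑ n ∈ sumF F, ((repF F n).card : ℝ) = ρ ^ 6 := by
    have := sum_repF F
    have h2 : (∑ n ∈ sumF F, ((repF F n).card : ℝ)) = (F.card : ℝ) ^ 2 := by exact_mod_cast this
    rw [h2, ← hρF]; ring
  -- classes
  let cls : ℕ → Finset (Fin 4 → ℤ) := fun j => N.filter (fun n => Nat.log 2 (degF F n).card = j)
  have hclass : ∀ j ∈ Finset.range L,
      (∑ n ∈ cls j, ((repF F n).card : ℝ) ^ 2 ≤ 8 * W ^ 8 * ρ ^ 7) ∧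
      (∑ n ∈ cls j, ((repF F n).card : ℝ) ^ 3 ≤ 16 * W ^ 8 * (ρ ^ 8 + ρ ^ 3 * s ^ 2)) := by
    intro j _
    have hsub : ∀ n ∈ cls j, n ∈ N := fun n hn => (Finset.mem_filter.1 hn).1
    have hd0 : ∀ n ∈ cls j, (degF F n).card ≠ 0 := by
      intro n hn
      have h1 := repF_pos F n (hNmem n (hsub n hn)).2
      have h2 := repF_le_degF F m hF n
      omega
    have hlow : ∀ n ∈ cls j, ((2:ℝ) ^ j) ≤ ((degF F n).card : ℝ) := by
      intro n hn
      have h := Nat.pow_log_le_self 2 (hd0 n hn)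
      rw [(Finset.mem_filter.1 hn).2] at h
      exact_mod_cast h
    have hup : ∀ n ∈ cls j, ((degF F n).card : ℝ) ≤ 2 * (2:ℝ) ^ j := by
      intro n hn
      have h := Nat.lt_pow_succ_log_self (b := 2) (by norm_num) (degF F n).card
      rw [(Finset.mem_filter.1 hn).2] at h
      have h' : (degF F n).card ≤ 2 * 2 ^ j := by
        rw [Nat.succ_eq_add_one, pow_succ] at h; omega
      exact_mod_cast h'
    refine aux_class_energy (cls j) (fun n => ((repF F n).card : ℝ))
      (fun n => ((degF F n).card : ℝ)) ((2:ℝ) ^ j) K G W ρ s hK hKW hG0 hGW hρ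
      (one_le_pow₀ (by norm_num)) (fun n _ => Nat.cast_nonneg _) ?_ hlow hup
      (fun n _ => hs n) (fun n _ => hrP n) ?_ ?_ ?_
    · intro n _
      exact_mod_cast repF_le_degF F m hF n
    · rw [← hsumsq]
      refine Finset.sum_le_sum_of_subset_of_nonneg ?_ (fun n _ _ => Nat.cast_nonneg _)
      intro n hn
      exact (hNmem n (hsub n hn)).2
    · intro h1 h2
      rw [hρF] at h2 ⊢
      exact lat_rich' F (cls j) K ((2:ℝ)^j) G hK h1 h2 hGdef
        (fun n hn => (hNmem n (hsub n hn)).1) hlow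
        (fun n hn n' hn' hne => hcod n (hsub n hn) n' (hsub n' hn') hne)
    · rw [hρF]
      exact aux_kst (cls j) F (fun n => degF F n) K (by linarith)
        (fun n _ => Finset.filter_subset _ _)
        (fun n hn n' hn' hne => hcod n (hsub n hn) n' (hsub n' hn') hne)
  have hmaps : ∀ n ∈ N, Nat.log 2 (degF F n).card ∈ Finset.range L := by
    intro n _
    rw [Finset.mem_range, hL, Nat.lt_succ_iff]
    exact Nat.log_mono_right (degF_le F n)
  have hsplit : ∀ k : ℕ, ∑ n ∈ sumF F, ((repF F n).card : ℝ) ^ k ≤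
      ((repF F 0).card : ℝ) ^ k +
        ∑ j ∈ Finset.range L, ∑ n ∈ cls j, ((repF F n).card : ℝ) ^ k := by
    intro k
    have h1 : ∑ j ∈ Finset.range L, ∑ n ∈ cls j, ((repF F n).card : ℝ) ^ k
        = ∑ n ∈ N, ((repF F n).card : ℝ) ^ k := Finset.sum_fiberwise_of_maps_to hmaps _
    rw [h1]
    by_cases h0 : (0 : Fin 4 → ℤ) ∈ sumF F
    · rw [hN, Finset.add_sum_erase _ (fun n => ((repF F n).card : ℝ) ^ k) h0]
    · rw [hN, Finset.erase_eq_of_notMem h0]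
      have : (0:ℝ) ≤ ((repF F 0).card : ℝ) ^ k := pow_nonneg (Nat.cast_nonneg _) k
      linarith
  have hr00 : (0:ℝ) ≤ ((repF F 0).card : ℝ) := Nat.cast_nonneg _
  have hr0P := hrP 0
  have hr0s := hs 0
  have hW9 : (1:ℝ) ≤ W ^ 9 := one_le_pow₀ hW1
  generalize ((repF F 0).card : ℝ) = r0 at *
  constructor
  · refine (hsplit 2).trans ?_
    have hc : ∑ j ∈ Finset.range L, ∑ n ∈ cls j, ((repF F n).card : ℝ) ^ 2
        ≤ L * (8 * W ^ 8 * ρ ^ 7) := by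
      refine (Finset.sum_le_sum fun j hj => (hclass j hj).1).trans ?_
      rw [Finset.sum_const, Finset.card_range, nsmul_eq_mul]
    have hc2 : (L : ℝ) * (8 * W ^ 8 * ρ ^ 7) ≤ W * (8 * W ^ 8 * ρ ^ 7) :=
      mul_le_mul_of_nonneg_right hLW (by positivity)
    have h0 : r0 ^ 2 ≤ (ρ ^ 3) ^ 2 := pow_le_pow_left₀ hr00 hr0P 2
    have h1 : (ρ ^ 3) ^ 2 ≤ ρ ^ 7 := by
      rw [← pow_mul]; exact pow_le_pow_right₀ hρ (by norm_num)
    have h2 : ρ ^ 7 ≤ W ^ 9 * ρ ^ 7 := le_mul_of_one_le_left (by positivity) hW9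
    have e : W * (8 * W ^ 8 * ρ ^ 7) = 8 * (W ^ 9 * ρ ^ 7) := by ring
    linarith
  · refine (hsplit 3).trans ?_
    have hc : ∑ j ∈ Finset.range L, ∑ n ∈ cls j, ((repF F n).card : ℝ) ^ 3
        ≤ L * (16 * W ^ 8 * (ρ ^ 8 + ρ ^ 3 * s ^ 2)) := by
      refine (Finset.sum_le_sum fun j hj => (hclass j hj).2).trans ?_
      rw [Finset.sum_const, Finset.card_range, nsmul_eq_mul]
    have hc2 : (L : ℝ) * (16 * W ^ 8 * (ρ ^ 8 + ρ ^ 3 * s ^ 2)) ≤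
        W * (16 * W ^ 8 * (ρ ^ 8 + ρ ^ 3 * s ^ 2)) :=
      mul_le_mul_of_nonneg_right hLW (by positivity)
    have h0 : r0 ^ 3 ≤ ρ ^ 3 * s ^ 2 := by
      have : r0 ^ 3 = r0 * r0 ^ 2 := by ring
      rw [this]
      exact mul_le_mul hr0P (pow_le_pow_left₀ hr00 hr0s 2) (by positivity) (by positivity)
    have h1 : ρ ^ 3 * s ^ 2 ≤ ρ ^ 8 + ρ ^ 3 * s ^ 2 := by
      have : 0 ≤ ρ ^ 8 := by positivity
      linarith
    have h2 : (ρ ^ 8 + ρ ^ 3 * s ^ 2) ≤ W ^ 9 * (ρ ^ 8 + ρ ^ 3 * s ^ 2) :=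
      le_mul_of_one_le_left (by positivity) hW9
    have e : W * (16 * W ^ 8 * (ρ ^ 8 + ρ ^ 3 * s ^ 2))
      = 16 * (W ^ 9 * (ρ ^ 8 + ρ ^ 3 * s ^ 2)) := by ring
    linarith

lemma lat_W (δ : ℝ) (hδ : 0 < δ) (CK : ℝ) (hCK : 1 ≤ CK) :
    ∃ Cw : ℝ, 1 ≤ Cw ∧ CK ≤ Cw ∧ ∀ m P : ℕ, 1 ≤ m → P ≤ (2 * m + 1) ^ 4 →
      320 * (20 * Real.log (2 * P + 17)) + 724 ≤ Cw * (m : ℝ) ^ δ := by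
  have hb : 0 ≤ 320 * (20 * ((179:ℝ) ^ (δ / 4) / (δ / 4))) := by positivity
  refine ⟨CK + 724 + 320 * (20 * ((179:ℝ) ^ (δ / 4) / (δ / 4))), by linarith, by linarith, ?_⟩
  intro m P hm hP
  have hm' : (1:ℝ) ≤ m := by exact_mod_cast hm
  have hP1 : (P : ℝ) ≤ (2 * m + 1) ^ 4 := by exact_mod_cast hP
  have hP2 : ((2 * m + 1 : ℝ)) ^ 4 ≤ (3 * m) ^ 4 :=
    pow_le_pow_left₀ (by linarith) (by linarith) 4
  have hm4 : (1:ℝ) ≤ (m:ℝ) ^ 4 := one_le_pow₀ hm'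
  have hx : (2 * P + 17 : ℝ) ≤ 179 * (m:ℝ) ^ 4 := by
    rw [mul_pow] at hP2; linarith
  have hP0 : (0:ℝ) ≤ P := Nat.cast_nonneg _
  have h1 : Real.log (2 * P + 17) ≤ (2 * P + 17 : ℝ) ^ (δ / 4) / (δ / 4) :=
    Real.log_le_rpow_div (by linarith) (by linarith)
  have h2 : (2 * P + 17 : ℝ) ^ (δ / 4) ≤ (179:ℝ) ^ (δ / 4) * (m:ℝ) ^ δ := by
    refine (Real.rpow_le_rpow (by linarith) hx (by linarith)).trans ?_
    rw [Real.mul_rpow (by norm_num) (by positivity)]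
    have : ((m:ℝ) ^ 4) ^ (δ / 4) = (m:ℝ) ^ δ := by
      rw [← Real.rpow_natCast, ← Real.rpow_mul (by linarith)]
      congr 1; push_cast; ring
    rw [this]
  have h3 : Real.log (2 * P + 17) ≤ (179:ℝ) ^ (δ / 4) / (δ / 4) * (m:ℝ) ^ δ := by
    refine h1.trans ?_
    rw [div_mul_eq_mul_div]
    exact div_le_div_of_nonneg_right h2 (by linarith)
  have h4 : (1:ℝ) ≤ (m:ℝ) ^ δ := Real.one_le_rpow hm' hδ.le
  nlinarith

theorem statement_17 (ε : ℝ) (hε : 0 < ε) :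
    ∃ C : ℝ, 0 < C ∧
      ∀ m : ℕ, 0 < m → ∀ A : Set (Fin 4 → ℤ), A.Finite → A.Nonempty → A ⊆ latSphere 4 m →
        (multiEnergy 2 2 A : ℝ) ≤ C * (m : ℝ) ^ ε * (A.ncard : ℝ) ^ (2 + (1 : ℝ) / 3) ∧
        (multiEnergy 2 3 A : ℝ) ≤ C * (m : ℝ) ^ ε *
          ((A.ncard : ℝ) ^ (2 + (2 : ℝ) / 3) +
            (A.ncard : ℝ) * (↑(⨆ n : Fin 4 → ℤ, repCount 2 A n) : ℝ) ^ 2) := by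
  obtain ⟨CK, hCK, hcirc⟩ := aux_circle (ε / 9) (by linarith)
  obtain ⟨Cw, hCw1, hCKw, hW⟩ := lat_W (ε / 9) (by linarith) CK hCK
  refine ⟨17 * Cw ^ 9, by positivity, ?_⟩
  intro m hm A hfin hne hsub
  obtain ⟨F, rfl⟩ : ∃ F : Finset (Fin 4 → ℤ), (F : Set (Fin 4 → ℤ)) = A :=
    ⟨hfin.toFinset, hfin.coe_toFinset⟩
  have hFne : F.Nonempty := Finset.coe_nonempty.1 hne
  have hF : ∀ x ∈ F, ∑ t, x t ^ 2 = (m : ℤ) := fun x hx => hsub hx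
  rw [Set.ncard_coe_finset]
  simp only [repCount_eq_repF]
  have hbdd : BddAbove (Set.range fun n : Fin 4 → ℤ => (repF F n).card) := by
    refine ⟨F.card, ?_⟩
    rintro _ ⟨n, rfl⟩
    exact (repF_le_degF F m hF n).trans (degF_le F n)
  set s : ℕ := ⨆ n : Fin 4 → ℤ, (repF F n).card with hsdef
  have hs : ∀ n, ((repF F n).card : ℝ) ≤ (s : ℝ) := by
    intro n
    exact_mod_cast le_ciSup hbdd n
  have hm1 : (1:ℝ) ≤ m := by exact_mod_cast hm
  have hmε : (1:ℝ) ≤ (m:ℝ) ^ (ε / 9) := Real.one_le_rpow hm1 (by linarith)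
  have hP1 : (1:ℝ) ≤ F.card := by exact_mod_cast Finset.card_pos.2 hFne
  have hP0 : (0:ℝ) < F.card := by linarith
  have hρ3 : ∀ k : ℕ, ((F.card : ℝ) ^ ((1:ℝ) / 3)) ^ k = (F.card : ℝ) ^ ((k : ℝ) / 3) := by
    intro k
    rw [← Real.rpow_natCast, ← Real.rpow_mul hP0.le]
    congr 1; ring
  obtain ⟨h2, h3⟩ := lat_energy m (CK * (m:ℝ) ^ (ε / 9)) (Cw * (m:ℝ) ^ (ε / 9))
    ((F.card : ℝ) ^ ((1:ℝ) / 3)) s (by nlinarith) F hF hFne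
    (hcirc m hm) (mul_le_mul_of_nonneg_right hCKw (by linarith))
    (hW m F.card hm (card_le_box m F hF))
    (Real.one_le_rpow hP1 (by norm_num))
    (by rw [hρ3]; norm_num) hs
  have hW9 : (Cw * (m:ℝ) ^ (ε / 9)) ^ 9 = Cw ^ 9 * (m:ℝ) ^ ε := by
    rw [mul_pow, ← Real.rpow_natCast ((m:ℝ) ^ (ε / 9)), ← Real.rpow_mul (by linarith)]
    congr 2; push_cast; ring
  have e7 : ((F.card : ℝ) ^ ((1:ℝ) / 3)) ^ 7 = (F.card : ℝ) ^ (2 + (1 : ℝ) / 3) := by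
    rw [hρ3]; norm_num
  have e8 : ((F.card : ℝ) ^ ((1:ℝ) / 3)) ^ 8 = (F.card : ℝ) ^ (2 + (2 : ℝ) / 3) := by
    rw [hρ3]; norm_num
  have e3 : ((F.card : ℝ) ^ ((1:ℝ) / 3)) ^ 3 = (F.card : ℝ) := by
    rw [hρ3]; norm_num
  rw [hW9, e7] at h2
  rw [hW9, e8, e3] at h3
  have m2 : (multiEnergy 2 2 (F : Set (Fin 4 → ℤ)) : ℝ) ≤
      ∑ n ∈ sumF F, ((repF F n).card : ℝ) ^ 2 := by
    exact_mod_cast multiEnergy_le F 1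
  have m3 : (multiEnergy 2 3 (F : Set (Fin 4 → ℤ)) : ℝ) ≤
      ∑ n ∈ sumF F, ((repF F n).card : ℝ) ^ 3 := by
    exact_mod_cast multiEnergy_le F 2
  have hmm : (0:ℝ) ≤ (m:ℝ) ^ ε := Real.rpow_nonneg (by linarith) _
  have hC9 : (0:ℝ) ≤ Cw ^ 9 := by positivity
  have hPp : (0:ℝ) ≤ (F.card : ℝ) ^ (2 + (1 : ℝ) / 3) := Real.rpow_nonneg hP0.le _
  constructor
  · refine m2.trans (h2.trans ?_)
    refine mul_le_mul_of_nonneg_right ?_ hPp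
    have := mul_nonneg hC9 hmm
    linarith
  · refine m3.trans (h3.trans (le_of_eq ?_))
    ring
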